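/- arXiv:1904.12698 — 7 statements merged into one kernel-verified Lean document; each statement's English description precedes it below -/
import Mathlib

section
/- Let d, k ≥ 1 be integers with k ≥ d + 1 and let ε > 0. There exists a constant C (depending only on d, k and ε) such that for every finite simple graph G with n ≥ 2 vertices whose maximum average degree is at most d − ε, the reconfiguration graph R_k(G) of k-colorings of G is connected and has diameter at most C · n · (log n)^{d−1}. -/
/-- A proper `k`-coloring of a simple graph. -/
def ProperColoring {V : Type} (G : SimpleGraph V) (k : ℕ) (f : V → Fin k) : Prop :=
  ∀ ⦃u v : V⦄, G.Adj u v → f u ≠ f v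

/-- Two colorings differ in the color of exactly one vertex. -/
def DiffersAtExactlyOne {V : Type} {k : ℕ} (f g : V → Fin k) : Prop :=
  ∃! v : V, f v ≠ g v

/-- A walk of length `m` in the reconfiguration graph `R_k(G)`: every step is a proper
coloring and consecutive colorings differ at exactly one vertex. -/
def RecoloringSeq {V : Type} (G : SimpleGraph V) (k m : ℕ) (c : ℕ → V → Fin k) : Prop :=
  (∀ i ≤ m, ProperColoring G k (c i)) ∧
  (∀ i < m, DiffersAtExactlyOne (c i) (c (i + 1)))

section Reconfiguration

variable {V : Type} {G : SimpleGraph V} {k : ℕ}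

/-- The reconfiguration graph `R_k(G)`. -/
def reconfigurationGraph (G : SimpleGraph V) (k : ℕ) :
    SimpleGraph {f : V → Fin k // ProperColoring G k f} where
  Adj x y := DiffersAtExactlyOne x.1 y.1
  symm := ⟨fun x y h => by simpa only [DiffersAtExactlyOne, ne_comm] using h⟩
  loopless := ⟨fun x h => by obtain ⟨v, hv, -⟩ := h; exact hv rfl⟩

/-- The coloring `x` can be turned into `y` in at most `m` recoloring steps. -/
def RecolorableWithin (G : SimpleGraph V) (k m : ℕ) (x y : V → Fin k) : Prop :=
  ∃ (hx : ProperColoring G k x) (hy : ProperColoring G k y),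
    ∃ p : (reconfigurationGraph G k).Walk ⟨x, hx⟩ ⟨y, hy⟩, p.length ≤ m

namespace RecolorableWithin

variable {m n : ℕ} {x y z : V → Fin k}

theorem refl (hx : ProperColoring G k x) (m : ℕ) : RecolorableWithin G k m x x :=
  ⟨hx, hx, .nil, by simp⟩

theorem symm (h : RecolorableWithin G k m x y) : RecolorableWithin G k m y x := by
  obtain ⟨hx, hy, p, hp⟩ := h
  exact ⟨hy, hx, p.reverse, by simpa using hp⟩

theorem trans (h : RecolorableWithin G k m x y) (h' : RecolorableWithin G k n y z) :
    RecolorableWithin G k (m + n) x z := by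
  obtain ⟨hx, hy, p, hp⟩ := h
  obtain ⟨_, hz, q, hq⟩ := h'
  exact ⟨hx, hz, p.append q, by rw [SimpleGraph.Walk.length_append]; omega⟩

theorem mono (h : RecolorableWithin G k m x y) (hmn : m ≤ n) : RecolorableWithin G k n x y := by
  obtain ⟨hx, hy, p, hp⟩ := h
  exact ⟨hx, hy, p, hp.trans hmn⟩

theorem exists_recoloringSeq (h : RecolorableWithin G k n x y) :
    ∃ m ≤ n, ∃ c : ℕ → V → Fin k, c 0 = x ∧ c m = y ∧ RecoloringSeq G k m c := by
  obtain ⟨hx, hy, p, hp⟩ := h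
  refine ⟨p.length, hp, fun i => (p.getVert i).1, by simp, by simp,
    fun i _ => (p.getVert i).2, fun i hi => p.adj_getVert_succ hi⟩

/-- If no vertex has the same color in `x` as one of its neighbors in `y`, then the vertices can
be recolored from `x` to `y` one after the other. -/
theorem of_forall_ne [Fintype V] [DecidableEq V]
    (hx : ProperColoring G k x) (hy : ProperColoring G k y)
    (h : ∀ ⦃u v⦄, G.Adj u v → x u ≠ y v) : RecolorableWithin G k (Fintype.card V) x y := by
  suffices H : ∀ n (x : V → Fin k), ProperColoring G k x → (∀ ⦃u v⦄, G.Adj u v → x u ≠ y v) →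
      (Finset.univ.filter fun v => x v ≠ y v).card = n → RecolorableWithin G k n x y from
    (H _ x hx h rfl).mono (Finset.card_le_univ _)
  intro n
  induction n with
  | zero =>
    intro x hx _ hn
    have hxy : x = y := by
      ext1 v
      have := Finset.filter_eq_empty_iff.1 (Finset.card_eq_zero.1 hn) (Finset.mem_univ v)
      simpa using this
    exact hxy ▸ refl hx 0
  | succ n ih =>
    intro x hx h hn
    obtain ⟨w, hw⟩ := Finset.card_pos.1 (by omega : 0 < (Finset.univ.filter fun v => x v ≠ y v).card)
    have hw' : x w ≠ y w := by simpa using hw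
    have hx' : ProperColoring G k (Function.update x w (y w)) := by
      intro u v huv
      have := huv.ne
      have h1 := h huv
      have h2 := h huv.symm
      have h3 := hx huv
      simp only [Function.update_apply]
      grind
    have hstep : RecolorableWithin G k 1 x (Function.update x w (y w)) := by
      suffices h : (reconfigurationGraph G k).Adj ⟨x, hx⟩ ⟨_, hx'⟩ from
        ⟨hx, hx', h.toWalk, by simp⟩
      refine ⟨w, by simpa using hw', fun v hv => ?_⟩
      by_contra hvw
      exact hv (by simp [hvw])
    have hrest := ih (Function.update x w (y w)) hx' (fun u v huv => by
      have := hy huv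
      have := h huv
      simp only [Function.update_apply]
      grind) (by
      have : (Finset.univ.filter fun v => Function.update x w (y w) v ≠ y v) =
          (Finset.univ.filter fun v => x v ≠ y v).erase w := by
        ext v
        by_cases hvw : v = w <;> simp [hvw]
      rw [this, Finset.card_erase_of_mem hw, hn]
      rfl)
    exact (hstep.trans hrest).mono (by omega)

/-- Colorings that differ only by erasing the color `q` can be transformed directly. -/
theorem of_eq_or_eq [Fintype V] [DecidableEq V] {q : Fin k}
    (hx : ProperColoring G k x) (hy : ProperColoring G k y)
    (h : ∀ v, x v = y v ∨ x v = q) (hq : ∀ v, y v = q → x v = q) :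
    RecolorableWithin G k (Fintype.card V) x y := by
  refine of_forall_ne hx hy fun u v huv => ?_
  have := hx huv
  have := hy huv
  have := h u
  have := hq v
  grind

end RecolorableWithin

/-- A greedily chosen independent set: every vertex of `B` outside it has a neighbor
in `K`, or a neighbor of higher level in the set. -/
theorem exists_greedy_indepSet [DecidableEq V] {ℓ : V → ℕ} (B : Finset V)
    (hℓ : ∀ u ∈ B, ∀ v ∈ B, G.Adj u v → ℓ u ≠ ℓ v) (K : Finset V) :
    ∃ S ⊆ B, (∀ u ∈ S, ∀ v ∈ S ∪ K, ¬ G.Adj u v) ∧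
      ∀ v ∈ B, v ∉ S → ∃ u, G.Adj v u ∧ (u ∈ K ∨ (u ∈ S ∧ ℓ v < ℓ u)) := by
  induction B using Finset.induction_on_max_value ℓ generalizing K with
  | empty => exact ⟨∅, by simp⟩
  | insert a s ha hmax ih =>
    have hℓ' : ∀ u ∈ s, ∀ v ∈ s, G.Adj u v → ℓ u ≠ ℓ v := fun u hu v hv =>
      hℓ u (Finset.mem_insert_of_mem hu) v (Finset.mem_insert_of_mem hv)
    by_cases hK : ∃ u ∈ K, G.Adj a u
    · obtain ⟨S, hS, hind, hdom⟩ := ih hℓ' K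
      refine ⟨S, hS.trans (Finset.subset_insert a s), hind, fun v hv hvS => ?_⟩
      rcases Finset.mem_insert.1 hv with rfl | hv
      · obtain ⟨u, hu, hau⟩ := hK
        exact ⟨u, hau, .inl hu⟩
      · exact hdom v hv hvS
    · push Not at hK
      obtain ⟨S, hS, hind, hdom⟩ := ih hℓ' (insert a K)
      refine ⟨insert a S, Finset.insert_subset_insert a hS, fun u hu v hv huv => ?_,
        fun v hv hvS => ?_⟩
      · have h1 := hind u
        have h2 := hind v
        have h3 := huv.symm
        have h4 := huv.ne
        simp only [Finset.mem_insert, Finset.mem_union] at *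
        grind
      · rw [Finset.mem_insert, not_or] at hvS
        have hv' : v ∈ s := Finset.mem_of_mem_insert_of_ne hv hvS.1
        obtain ⟨u, hvu, hu⟩ := hdom v hv' hvS.2
        have := hℓ v hv a (Finset.mem_insert_self a s)
        have := hmax v hv'
        refine ⟨u, hvu, ?_⟩
        simp only [Finset.mem_insert] at *
        grind

variable [Fintype V] [DecidableEq V]

open Classical in
/-- The neighbors of `v` that are later than `v`: those in `A` of a higher level, and those
outside `A` whose color in `x` belongs to `Q`. -/
noncomputable def laterNeighbors (G : SimpleGraph V) (ℓ : V → ℕ) (A : Finset V)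
    (Q : Finset (Fin k)) (x : V → Fin k) (v : V) : Finset V :=
  {u | G.Adj v u ∧ ((u ∈ A ∧ ℓ v < ℓ u) ∨ (u ∉ A ∧ x u ∈ Q))}

theorem mem_laterNeighbors {ℓ : V → ℕ} {A : Finset V} {Q : Finset (Fin k)} {x : V → Fin k}
    {u v : V} : u ∈ laterNeighbors G ℓ A Q x v ↔
      G.Adj v u ∧ ((u ∈ A ∧ ℓ v < ℓ u) ∨ (u ∉ A ∧ x u ∈ Q)) := by
  simp [laterNeighbors]

/-- Greedy extension of a partial coloring. -/
theorem exists_greedy_extension {ℓ : V → ℕ} (R : Finset (Fin k)) (B : Finset V)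
    (hℓ : ∀ u ∈ B, ∀ v ∈ B, G.Adj u v → ℓ u ≠ ℓ v) (x : V → Fin k)
    (hx : ∀ u v, u ∉ B → v ∉ B → G.Adj u v → x u ≠ x v)
    (hR : ∀ v ∈ B, (laterNeighbors G ℓ B R x v).card < R.card) :
    ∃ y, ProperColoring G k y ∧ (∀ v ∉ B, y v = x v) ∧ ∀ v ∈ B, y v ∈ R := by
  induction B using Finset.induction_on_max_value ℓ generalizing x with
  | empty => exact ⟨x, fun u v huv => hx u v (by simp) (by simp) huv, by simp, by simp⟩
  | insert a s ha hmax ih =>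
    obtain ⟨c, hc, hc'⟩ : ∃ c ∈ R, c ∉ (laterNeighbors G ℓ (insert a s) R x a).image x :=
      Finset.exists_mem_notMem_of_card_lt_card
        (Finset.card_image_le.trans_lt (hR a (Finset.mem_insert_self a s)))
    have hc'' : ∀ u, u ∉ insert a s → G.Adj a u → x u ≠ c := by
      rintro u hu hau rfl
      exact hc' (Finset.mem_image_of_mem _ (mem_laterNeighbors.2 ⟨hau, .inr ⟨hu, hc⟩⟩))
    obtain ⟨y, hy, hyx, hyR⟩ := ih
      (fun u hu v hv => hℓ u (Finset.mem_insert_of_mem hu) v (Finset.mem_insert_of_mem hv))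
      (Function.update x a c) (fun u v hu hv huv => by
        have := huv.ne
        have := hc'' u
        have := hc'' v
        have := hx u v
        have := huv.symm
        simp only [Function.update_apply, Finset.mem_insert] at *
        grind) (fun v hv => by
        refine (Finset.card_le_card fun u hu => ?_).trans_lt (hR v (Finset.mem_insert_of_mem hv))
        rw [mem_laterNeighbors] at hu ⊢
        have h1 := hmax v hv
        have h2 := hℓ v (Finset.mem_insert_of_mem hv) a (Finset.mem_insert_self a s)
        simp only [Function.update_apply, Finset.mem_insert] at *
        grind)
    refine ⟨y, hy, fun v hv => ?_, fun v hv => ?_⟩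
    · rw [Finset.mem_insert, not_or] at hv
      rw [hyx v hv.2, Function.update_of_ne hv.1]
    · rcases Finset.mem_insert.1 hv with rfl | hv
      · rw [hyx v ha, Function.update_self]
        exact hc
      · exact hyR v hv

/-- Giving the color `q` to an independent set `S` of vertices. -/
theorem recolorableWithin_ite {S F K : Finset V} {q : Fin k} {a : V → Fin k}
    (ha : ProperColoring G k a) (hK : ∀ v, v ∈ K ↔ v ∉ F ∧ a v = q)
    (haF : ∀ v ∈ F, a v ≠ q) (hS : ∀ u ∈ S, ∀ v ∈ S ∪ K, ¬ G.Adj u v) :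
    RecolorableWithin G k (Fintype.card V) a (fun v => if v ∈ S then q else a v) := by
  have hb : ProperColoring G k (fun v => if v ∈ S then q else a v) := by
    intro u v huv
    have h1 := hS u
    have h2 := hS v
    have h3 := ha huv
    have h4 := hK u
    have h5 := hK v
    have h6 := haF u
    have h7 := haF v
    have h8 := huv.symm
    simp only [Finset.mem_union] at *
    grind
  refine (RecolorableWithin.of_eq_or_eq hb ha (q := q) (fun v => ?_) (fun v hv => ?_)).symm
  · by_cases hv : v ∈ S <;> simp [hv]
  · simp [hv]

/-- `RecolorableOn G ℓ k s N` says: if the vertices of `A` use colors from a palette of at least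
`s + 2` colors, and each has at most `s` later neighbors, then any two colorings agreeing outside
`A` are within `N` recoloring steps. -/
def RecolorableOn (G : SimpleGraph V) (ℓ : V → ℕ) (k s N : ℕ) : Prop :=
  ∀ (Q : Finset (Fin k)) (A : Finset V) (x y : V → Fin k), s + 2 ≤ Q.card →
    ProperColoring G k x → ProperColoring G k y → (∀ v ∉ A, x v = y v) →
    (∀ v ∈ A, x v ∈ Q) → (∀ v ∈ A, y v ∈ Q) →
    (∀ v ∈ A, (laterNeighbors G ℓ A Q x v).card ≤ s) → RecolorableWithin G k N x y

section Step

variable {ℓ : V → ℕ} {s N : ℕ}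

theorem laterNeighbors_congr {A : Finset V} {Q : Finset (Fin k)} {x y : V → Fin k}
    (h : ∀ v ∉ A, x v = y v) (v : V) : laterNeighbors G ℓ A Q x v = laterNeighbors G ℓ A Q y v := by
  ext u
  have := h u
  rw [mem_laterNeighbors, mem_laterNeighbors]
  grind

theorem recolorableOn_zero (hℓ : ∀ ⦃u v⦄, G.Adj u v → ℓ u ≠ ℓ v) :
    RecolorableOn G ℓ k 0 (Fintype.card V) := by
  intro Q A x y _ hx hy hxy hxQ hyQ hlate
  refine .of_forall_ne hx hy fun u v huv => ?_
  have hempty : ∀ v ∈ A, ∀ u, u ∉ laterNeighbors G ℓ A Q x v := by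
    intro v hv u
    rw [Finset.card_eq_zero.1 (Nat.le_zero.1 (hlate v hv))]
    simp
  simp only [mem_laterNeighbors] at hempty
  have h1 := hempty u
  have h2 := hempty v
  have h3 := hℓ huv
  have h4 := hx huv
  have h5 := hxy u
  have h6 := hxy v
  have h7 := hxQ u
  have h8 := hyQ v
  have h9 := huv.symm
  have h10 := hy huv
  grind

/-- Recoloring `F` to a coloring in which the greedy independent set `S` has color `q`: inside
`F \ S` every vertex has a later neighbor of color `q`, so the number of later neighbors drops. -/
theorem RecolorableOn.recolorableWithin_of_greedy (h : RecolorableOn G ℓ k s N)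
    {Q : Finset (Fin k)} {A F S K : Finset V} {q : Fin k} {a c : V → Fin k}
    (hQ : s + 3 ≤ Q.card) (hq : q ∈ Q)
    (ha : ProperColoring G k a) (hc : ProperColoring G k c)
    (haQ : ∀ v ∈ A, a v ∈ Q)
    (hlate : ∀ v ∈ A, (laterNeighbors G ℓ A Q a v).card ≤ s + 1)
    (hFA : F ⊆ A) (hF : ∀ v ∈ F, ∀ u ∈ A, u ∉ F → ℓ v < ℓ u)
    (haF : ∀ v ∈ F, a v ≠ q)
    (hSF : S ⊆ F) (hK : ∀ v, v ∈ K ↔ v ∉ F ∧ a v = q)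
    (hS : ∀ u ∈ S, ∀ v ∈ S ∪ K, ¬ G.Adj u v)
    (hdom : ∀ v ∈ F, v ∉ S → ∃ u, G.Adj v u ∧ (u ∈ K ∨ (u ∈ S ∧ ℓ v < ℓ u)))
    (hca : ∀ v ∉ F, c v = a v) (hcS : ∀ v ∈ S, c v = q)
    (hcQ : ∀ v ∈ F, v ∉ S → c v ∈ Q.erase q) :
    RecolorableWithin G k (Fintype.card V + N) a c := by
  have hab := recolorableWithin_ite ha hK haF hS
  refine hab.trans ?_
  obtain ⟨-, hb, -⟩ := id hab
  refine h (Q.erase q) (F \ S) _ c ?_ hb hc ?_ ?_ ?_ ?_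
  · rw [Finset.card_erase_of_mem hq]
    omega
  · intro v hv
    have := hca v
    have := hcS v
    grind
  · intro v hv
    rw [Finset.mem_sdiff] at hv
    simp only [hv.2, if_false]
    exact Finset.mem_erase.2 ⟨haF v hv.1, haQ v (hFA hv.1)⟩
  · intro v hv
    rw [Finset.mem_sdiff] at hv
    exact hcQ v hv.1 hv.2
  · intro v hv
    rw [Finset.mem_sdiff] at hv
    obtain ⟨w, hvw, hw⟩ := hdom v hv.1 hv.2
    have hwlate : w ∈ laterNeighbors G ℓ A Q a v := by
      rw [mem_laterNeighbors]
      have := hK w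
      have := hF v hv.1 w
      have := @hFA w
      have := @hSF w
      grind
    have hsub : laterNeighbors G ℓ (F \ S) (Q.erase q) (fun v => if v ∈ S then q else a v) v ⊆
        (laterNeighbors G ℓ A Q a v).erase w := by
      intro u hu
      rw [Finset.mem_erase]
      rw [mem_laterNeighbors] at hu ⊢
      have := hK w
      have := hF v hv.1 u
      have := @hFA u
      have := @hSF w
      simp only [Finset.mem_sdiff, Finset.mem_erase] at *
      grind
    have := Finset.card_le_card hsub
    rw [Finset.card_erase_of_mem hwlate] at this
    have := hlate v (hFA hv.1)
    omega

/-- Removing the color `q` from the levels up to `i`, given that it is already removed below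
`i`. -/
theorem RecolorableOn.exists_erase_level (h : RecolorableOn G ℓ k s N)
    (hℓ : ∀ ⦃u v⦄, G.Adj u v → ℓ u ≠ ℓ v)
    {Q : Finset (Fin k)} {A : Finset V} {q : Fin k} {a : V → Fin k}
    (hQ : s + 3 ≤ Q.card) (hq : q ∈ Q) (ha : ProperColoring G k a)
    (haQ : ∀ v ∈ A, a v ∈ Q)
    (hlate : ∀ v ∈ A, (laterNeighbors G ℓ A Q a v).card ≤ s + 1)
    (i : ℕ) (hi : ∀ v ∈ A, ℓ v < i → a v ≠ q) :
    ∃ b, RecolorableWithin G k (N + 2 * Fintype.card V) a b ∧ (∀ v ∉ A, a v = b v) ∧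
      (∀ v ∈ A, b v ∈ Q) ∧ ∀ v ∈ A, ℓ v < i + 1 → b v ≠ q := by
  set F := A.filter fun v => ℓ v < i with hF
  set B := A.filter fun v => ℓ v < i ∨ (ℓ v = i ∧ a v = q) with hB
  set K := Finset.univ.filter fun v => v ∉ F ∧ a v = q with hK
  obtain ⟨S, hSF, hS, hdom⟩ := exists_greedy_indepSet F (fun u _ v _ => @hℓ u v) K
  obtain ⟨b, hb, hba, hbQ⟩ := exists_greedy_extension (G := G) (ℓ := ℓ) (Q.erase q) B
    (fun u _ v _ => @hℓ u v) a (fun u v _ _ => @ha u v) (fun v hv => by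
      rw [Finset.card_erase_of_mem hq]
      have hvA : v ∈ A := (Finset.mem_filter.1 hv).1
      have := hlate v hvA
      refine (Finset.card_le_card (fun u hu => ?_)).trans_lt (by omega :
        (laterNeighbors G ℓ A Q a v).card < _)
      rw [mem_laterNeighbors] at hu ⊢
      have := hℓ hu.1
      simp only [hB, Finset.mem_filter, Finset.mem_erase] at *
      grind)
  have hF' : ∀ v, v ∈ F ↔ v ∈ A ∧ ℓ v < i := fun v => by simp [hF]
  have hB' : ∀ v, v ∈ B ↔ v ∈ A ∧ (ℓ v < i ∨ (ℓ v = i ∧ a v = q)) := fun v => by simp [hB]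
  have hK' : ∀ v, v ∈ K ↔ v ∉ F ∧ a v = q := fun v => by simp [hK]
  have hSF' : ∀ v ∈ S, v ∈ F := fun v hv => hSF hv
  simp only [Finset.mem_erase] at hbQ
  have hc : ProperColoring G k (fun v => if v ∈ S then q else if v ∈ F then b v else a v) := by
    intro u v huv
    have h1 := hS u
    have h2 := hS v
    have h3 := ha huv
    have h4 := hb huv
    have h5 := huv.symm
    have h6 := hba u
    have h7 := hba v
    have h8 := hbQ u
    have h9 := hbQ v
    simp only [Finset.mem_union] at *
    grind
  refine ⟨b, ?_, ?_, ?_, ?_⟩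
  · have h1 : RecolorableWithin G k (Fintype.card V + N) a _ :=
      h.recolorableWithin_of_greedy (A := A) hQ hq ha hc haQ hlate
        (Finset.filter_subset _ _) (by grind) (by grind) hSF hK' hS hdom (by grind) (by grind)
        (by grind)
    refine (h1.trans (RecolorableWithin.of_eq_or_eq hc hb (q := q) ?_ ?_)).mono (by omega)
    · grind
    · grind
  · grind
  · grind
  · grind

theorem RecolorableOn.exists_erase_color (h : RecolorableOn G ℓ k s N)
    (hℓ : ∀ ⦃u v⦄, G.Adj u v → ℓ u ≠ ℓ v)
    {Q : Finset (Fin k)} {A : Finset V} {q : Fin k} {a : V → Fin k}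
    (hQ : s + 3 ≤ Q.card) (hq : q ∈ Q) (ha : ProperColoring G k a)
    (haQ : ∀ v ∈ A, a v ∈ Q)
    (hlate : ∀ v ∈ A, (laterNeighbors G ℓ A Q a v).card ≤ s + 1) (i : ℕ) :
    ∃ b, RecolorableWithin G k (i * (N + 2 * Fintype.card V)) a b ∧ (∀ v ∉ A, a v = b v) ∧
      (∀ v ∈ A, b v ∈ Q) ∧ ∀ v ∈ A, ℓ v < i → b v ≠ q := by
  induction i with
  | zero => exact ⟨a, .refl ha _, fun _ _ => rfl, haQ, by simp⟩
  | succ i ih =>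
    obtain ⟨b, hab, hAb, hbQ, hbq⟩ := ih
    obtain ⟨_, hb, -⟩ := id hab
    obtain ⟨c, hbc, hAc, hcQ, hcq⟩ := h.exists_erase_level hℓ hQ hq hb hbQ
      (fun v hv => laterNeighbors_congr (G := G) (ℓ := ℓ) (Q := Q) hAb v ▸ hlate v hv) i hbq
    exact ⟨c, (hab.trans hbc).mono ((Nat.succ_mul _ _).ge),
      fun v hv => (hAb v hv).trans (hAc v hv), hcQ, hcq⟩

theorem RecolorableOn.succ (h : RecolorableOn G ℓ k s N)
    (hℓ : ∀ ⦃u v⦄, G.Adj u v → ℓ u ≠ ℓ v) {t : ℕ} (ht : ∀ v, ℓ v < t) :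
    RecolorableOn G ℓ k (s + 1) ((2 * t + 1) * (N + 2 * Fintype.card V)) := by
  intro Q A x y hQ hx hy hxy hxQ hyQ hlate
  obtain ⟨q, hq⟩ := Finset.card_pos.1 (by omega : 0 < Q.card)
  obtain ⟨a, hxa, hAa, haQ, haq⟩ := h.exists_erase_color hℓ (by omega) hq hx hxQ hlate t
  obtain ⟨b, hyb, hAb, hbQ, hbq⟩ := h.exists_erase_color hℓ (by omega) hq hy hyQ
    (fun v hv => laterNeighbors_congr (G := G) (ℓ := ℓ) (Q := Q) hxy v ▸ hlate v hv) t
  have hab : ∀ v ∉ A, a v = b v := fun v hv => by rw [← hAa v hv, ← hAb v hv, hxy v hv]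
  obtain ⟨_, ha, -⟩ := id hxa
  obtain ⟨_, hb, -⟩ := id hyb
  set K := Finset.univ.filter fun v => v ∉ A ∧ a v = q with hK
  have hKa : ∀ v, v ∈ K ↔ v ∉ A ∧ a v = q := fun v => by simp [hK]
  have hKb : ∀ v, v ∈ K ↔ v ∉ A ∧ b v = q := fun v => by grind
  obtain ⟨S, hSA, hS, hdom⟩ := exists_greedy_indepSet A (fun u _ v _ => @hℓ u v) K
  have hbc := recolorableWithin_ite hb hKb (fun v hv => hbq v hv (ht v)) hS
  obtain ⟨_, hc, -⟩ := id hbc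
  have hac : RecolorableWithin G k (Fintype.card V + N) a _ :=
    h.recolorableWithin_of_greedy (A := A) (by omega) hq ha hc haQ
      (fun v hv => laterNeighbors_congr (G := G) (ℓ := ℓ) (Q := Q) hAa v ▸ hlate v hv)
      subset_rfl (by grind) (fun v hv => haq v hv (ht v)) hSA hKa hS hdom (by grind) (by grind)
      (fun v hv hvS => by simp [hvS, hbq v hv (ht v), hbQ v hv])
  refine (((hxa.trans hac).trans hbc.symm).trans hyb.symm).mono (le_of_eq ?_)
  ring

theorem recolorableOn (hℓ : ∀ ⦃u v⦄, G.Adj u v → ℓ u ≠ ℓ v) {t : ℕ} (ht : ∀ v, ℓ v < t)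
    (ht0 : 0 < t) (s : ℕ) : RecolorableOn G ℓ k s ((9 * t) ^ s * Fintype.card V) := by
  induction s with
  | zero => simpa using recolorableOn_zero hℓ
  | succ s ih =>
    intro Q A x y hQ hx hy hxy hxQ hyQ hlate
    refine (ih.succ hℓ ht Q A x y hQ hx hy hxy hxQ hyQ hlate).mono ?_
    have hN : Fintype.card V ≤ (9 * t) ^ s * Fintype.card V :=
      Nat.le_mul_of_pos_left _ (by positivity)
    calc (2 * t + 1) * ((9 * t) ^ s * Fintype.card V + 2 * Fintype.card V)
        ≤ (3 * t) * (3 * ((9 * t) ^ s * Fintype.card V)) := by gcongr <;> omega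
      _ = (9 * t) ^ (s + 1) * Fintype.card V := by ring

end Step

end Reconfiguration

section Sparse

variable {V : Type} [Fintype V] {G : SimpleGraph V} [DecidableRel G.Adj]

/-- A graph in which every vertex has fewer than `d` neighbors is `d`-colorable. -/
theorem exists_coloring_of_degree_lt [DecidableEq V] (G : SimpleGraph V) [DecidableRel G.Adj] {d : ℕ}
    (h : ∀ v, G.degree v < d) : ∃ f : V → Fin d, ∀ ⦃u v⦄, G.Adj u v → f u ≠ f v := by
  rcases isEmpty_or_nonempty V with _ | ⟨⟨v₀⟩⟩
  · exact ⟨fun v => isEmptyElim v, fun v => isEmptyElim v⟩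
  suffices H : ∀ s : Finset V, ∃ f : V → Fin d, ∀ u ∈ s, ∀ v ∈ s, G.Adj u v → f u ≠ f v by
    obtain ⟨f, hf⟩ := H Finset.univ
    exact ⟨f, fun u v => hf u (Finset.mem_univ u) v (Finset.mem_univ v)⟩
  intro s
  induction s using Finset.induction_on with
  | empty => exact ⟨fun _ => ⟨0, (Nat.zero_le _).trans_lt (h v₀)⟩, by simp⟩
  | insert a s ha ih =>
    obtain ⟨f, hf⟩ := ih
    obtain ⟨c, -, hc⟩ : ∃ c ∈ Finset.univ, c ∉ (G.neighborFinset a).image f :=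
      Finset.exists_mem_notMem_of_card_lt_card
        (Finset.card_image_le.trans_lt (by simpa using h a))
    have hc' : ∀ u, G.Adj a u → f u ≠ c := fun u hu hfu =>
      hc (Finset.mem_image.2 ⟨u, by simpa using hu, hfu⟩)
    refine ⟨Function.update f a c, fun u hu v hv huv => ?_⟩
    have := hc' u
    have := hc' v
    have := huv.ne
    have := huv.symm
    have := hf u
    have := hf v
    simp only [Function.update_apply, Finset.mem_insert] at *
    grind

/-- The sum of the degrees in the subgraph induced by `W` is bounded in terms of the maximum
average degree. -/
theorem sum_card_adj_le {D : ℝ}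
    (h : ∀ H : G.Subgraph, H.verts.Nonempty →
      2 * (H.edgeSet.ncard : ℝ) ≤ D * H.verts.ncard) {W : Finset V} (hW : W.Nonempty) :
    ((∑ v ∈ W, (W.filter (G.Adj v)).card : ℕ) : ℝ) ≤ D * W.card := by
  classical
  set H := (⊤ : G.Subgraph).induce W with hH
  have h1 := h H (by simpa [hH] using hW)
  have h2 : H.edgeSet.ncard = H.spanningCoe.edgeFinset.card := by
    rw [← Set.ncard_coe_finset, SimpleGraph.coe_edgeFinset]
    rfl
  have h3 : ∑ v ∈ W, (W.filter (G.Adj v)).card ≤ ∑ v, H.spanningCoe.degree v := by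
    refine (Finset.sum_le_sum fun v hv => ?_).trans
      (Finset.sum_le_sum_of_subset (Finset.subset_univ W))
    refine Finset.card_le_card fun u hu => ?_
    simpa [hH, hv] using hu
  rw [SimpleGraph.sum_degrees_eq_twice_card_edges, ← h2] at h3
  have h4 : H.verts.ncard = W.card := by simp [hH]
  rw [h4] at h1
  refine le_trans ?_ h1
  exact_mod_cast h3

/-- Repeatedly removing the vertices of degree less than `d`. -/
theorem exists_rank [DecidableEq V] {d : ℕ} {ε : ℝ} (hd : 1 ≤ d)
    (h : ∀ H : G.Subgraph, H.verts.Nonempty →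
      2 * (H.edgeSet.ncard : ℝ) ≤ ((d : ℝ) - ε) * H.verts.ncard)
    (hε : ε ≤ d) (r : ℕ) (W : Finset V) (hr : (1 - ε / d) ^ r * W.card < 1) :
    ∃ ρ : V → ℕ, ∀ v ∈ W, ρ v < r ∧ (W.filter fun u => G.Adj v u ∧ ρ v ≤ ρ u).card < d := by
  have hd0 : (0 : ℝ) < d := by exact_mod_cast hd
  have hε1 : 0 ≤ 1 - ε / d := by
    rw [sub_nonneg, div_le_one hd0]
    exact hε
  induction r generalizing W with
  | zero =>
    have : W.card = 0 := by
      rw [pow_zero, one_mul] at hr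
      exact_mod_cast Nat.lt_one_iff.1 (by exact_mod_cast hr)
    rw [Finset.card_eq_zero.1 this]
    exact ⟨fun _ => 0, by simp⟩
  | succ r ih =>
    rcases W.eq_empty_or_nonempty with rfl | hW
    · exact ⟨fun _ => 0, by simp⟩
    set W' := W.filter fun v => d ≤ (W.filter (G.Adj v)).card with hW'
    have hcard : (W'.card : ℝ) ≤ (1 - ε / d) * W.card := by
      have h1 : d * W'.card ≤ ∑ v ∈ W, (W.filter (G.Adj v)).card := by
        refine le_trans ?_ (Finset.sum_le_sum_of_subset (Finset.filter_subset _ W : W' ⊆ W))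
        rw [mul_comm, ← smul_eq_mul]
        exact Finset.card_nsmul_le_sum _ _ _ fun v hv => (Finset.mem_filter.1 hv).2
      have h2 := sum_card_adj_le h hW
      have h3 : (d : ℝ) * W'.card ≤ (d - ε) * W.card := le_trans (by exact_mod_cast h1) h2
      rw [one_sub_div hd0.ne', div_mul_eq_mul_div, le_div_iff₀ hd0]
      linarith
    obtain ⟨ρ, hρ⟩ := ih W' (by
      refine lt_of_le_of_lt ?_ hr
      rw [pow_succ, mul_assoc]
      gcongr)
    refine ⟨fun v => if v ∈ W' then ρ v + 1 else 0, fun v hv => ?_⟩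
    by_cases hvW' : v ∈ W'
    · obtain ⟨h1, h2⟩ := hρ v hvW'
      refine ⟨by simpa [hvW'] using h1, lt_of_le_of_lt (Finset.card_le_card fun u hu => ?_) h2⟩
      simp only [Finset.mem_filter (s := W), Finset.mem_filter (s := W'), hvW', if_true] at hu ⊢
      by_cases huW' : u ∈ W'
      · simpa [huW', hu.2.1] using hu.2.2
      · simp [huW'] at hu
    · refine ⟨by simp [hvW'], lt_of_le_of_lt (Finset.card_le_card
        (Finset.monotone_filter_right W fun u _ hu => hu.1)) ?_⟩
      by_contra hcon
      exact hvW' (Finset.mem_filter.2 ⟨hv, not_lt.1 hcon⟩)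

/-- Refining the ranks to levels that form independent sets. -/
theorem exists_levels_of_rank [DecidableEq V] {d r : ℕ} {ρ : V → ℕ}
    (hρ : ∀ v, ρ v < r ∧ (Finset.univ.filter fun u => G.Adj v u ∧ ρ v ≤ ρ u).card < d) :
    ∃ ℓ : V → ℕ, (∀ v, ℓ v < d * r) ∧ (∀ ⦃u v⦄, G.Adj u v → ℓ u ≠ ℓ v) ∧
      ∀ v, (Finset.univ.filter fun u => G.Adj v u ∧ ℓ v < ℓ u).card < d := by
  obtain ⟨f, hf⟩ := exists_coloring_of_degree_lt
    (SimpleGraph.mk (fun u v => G.Adj u v ∧ ρ u = ρ v) ⟨fun u v h => ⟨h.1.symm, h.2.symm⟩⟩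
      ⟨fun v h => h.1.ne rfl⟩ : SimpleGraph V) (d := d) (fun v => by
    refine lt_of_le_of_lt (Finset.card_le_card fun u hu => ?_) (hρ v).2
    simp only [SimpleGraph.mem_neighborFinset] at hu
    simp [hu.1, hu.2])
  have hdiv : ∀ v, (d * ρ v + f v) / d = ρ v := fun v => by
    rw [Nat.mul_add_div (f v).pos, Nat.div_eq_of_lt (f v).2, add_zero]
  refine ⟨fun v => d * ρ v + f v, fun v => ?_, fun u v huv heq => ?_, fun v => ?_⟩
  · calc d * ρ v + f v < d * ρ v + d := by have := (f v).2; omega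
      _ = d * (ρ v + 1) := by ring
      _ ≤ d * r := Nat.mul_le_mul_left d (hρ v).1
  · have hρuv : ρ u = ρ v := by rw [← hdiv u, ← hdiv v]; exact congrArg (· / d) heq
    refine hf ⟨huv, hρuv⟩ (Fin.ext ?_)
    simp only [hρuv] at heq
    omega
  · refine lt_of_le_of_lt (Finset.card_le_card
      (Finset.monotone_filter_right _ fun u _ hu => ⟨hu.1, ?_⟩)) (hρ v).2
    rw [← hdiv u, ← hdiv v]
    exact Nat.div_le_div_right hu.2.le

/-- Logarithmically many rounds suffice. -/
theorem exists_pow_mul_lt_one {q : ℝ} (hq0 : 0 ≤ q) (hq1 : q < 1) :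
    ∃ c : ℝ, 0 < c ∧ ∀ n : ℕ, 2 ≤ n →
      ∃ r : ℕ, 0 < r ∧ q ^ r * n < 1 ∧ (r : ℝ) ≤ c * Real.log n := by
  have hlog2 : 0 < Real.log 2 := Real.log_pos one_lt_two
  refine ⟨1 / (1 - q) + 1 / Real.log 2, by have := sub_pos.2 hq1; positivity, fun n hn => ?_⟩
  have hn0 : (0 : ℝ) < n := by exact_mod_cast (by omega : 0 < n)
  have hlog : Real.log 2 ≤ Real.log n := Real.log_le_log two_pos (by exact_mod_cast hn)
  have hq' := sub_pos.2 hq1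
  have hx : 0 ≤ Real.log n / (1 - q) := div_nonneg (hlog2.le.trans hlog) hq'.le
  refine ⟨⌊Real.log n / (1 - q)⌋₊ + 1, Nat.succ_pos _, ?_, ?_⟩
  · have h1 : q ≤ Real.exp (-(1 - q)) := by
      have := Real.add_one_le_exp (-(1 - q))
      linarith
    have h2 := Nat.lt_floor_add_one (Real.log n / (1 - q))
    rw [div_lt_iff₀ hq'] at h2
    calc q ^ (⌊Real.log n / (1 - q)⌋₊ + 1) * n
        ≤ Real.exp (-(1 - q)) ^ (⌊Real.log n / (1 - q)⌋₊ + 1) * Real.exp (Real.log n) := by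
          rw [Real.exp_log hn0]
          gcongr
      _ < 1 := by
          rw [← Real.exp_nat_mul, ← Real.exp_add, Real.exp_lt_one_iff]
          push_cast
          linarith
  · push_cast
    have h1 := Nat.floor_le hx
    have h2 : 1 ≤ 1 / Real.log 2 * Real.log n := by
      rw [one_div, inv_mul_eq_div, one_le_div hlog2]
      exact hlog
    calc _ ≤ Real.log n / (1 - q) + 1 / Real.log 2 * Real.log n := add_le_add h1 h2
      _ = _ := by ring

end Sparse

/-- For integers `d, k ≥ 1` with `k ≥ d + 1` and `ε > 0` there is a constant
`C` such that for every finite simple graph `G` with `n ≥ 2` vertices and maximum average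
degree at most `d - ε`, the reconfiguration graph `R_k(G)` is connected with diameter at most
`C * n * (log n)^(d-1)`: any two `k`-colorings are joined by a recoloring sequence of that
length. -/
theorem statement0 (d k : ℕ) (hd : 1 ≤ d) (hk : d + 1 ≤ k) (ε : ℝ) (hε : 0 < ε) :
    ∃ C : ℝ, ∀ (V : Type) [Fintype V] [DecidableEq V] (G : SimpleGraph V),
      2 ≤ Fintype.card V →
      (∀ H : G.Subgraph, H.verts.Nonempty →
        2 * (H.edgeSet.ncard : ℝ) ≤ ((d : ℝ) - ε) * H.verts.ncard) →
      ∀ α β : V → Fin k, ProperColoring G k α → ProperColoring G k β →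
        ∃ m : ℕ,
          (m : ℝ) ≤ C * (Fintype.card V : ℝ) * (Real.log (Fintype.card V)) ^ (d - 1) ∧
          ∃ c : ℕ → V → Fin k, c 0 = α ∧ c m = β ∧ RecoloringSeq G k m c := by

  classical
  have hd0 : (0 : ℝ) < d := by exact_mod_cast hd
  set ε' : ℝ := min ε d with hε'
  have hε'0 : 0 < ε' := lt_min hε hd0
  obtain ⟨c, hc0, hc⟩ := exists_pow_mul_lt_one (q := 1 - ε' / d)
    (sub_nonneg.2 ((div_le_one hd0).2 (min_le_right _ _)))
    (sub_lt_self 1 (div_pos hε'0 hd0))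
  refine ⟨(9 * d * c) ^ (d - 1), fun V _ _ G hn hG α β hα hβ => ?_⟩
  obtain ⟨r, hr0, hr, hrc⟩ := hc _ hn
  obtain ⟨ρ, hρ⟩ := exists_rank (G := G) (ε := ε') hd
    (fun H hH => (hG H hH).trans (by gcongr; exact min_le_left _ _))
    (min_le_right _ _) r Finset.univ hr
  obtain ⟨ℓ, hℓt, hℓ, hlate⟩ := exists_levels_of_rank fun v => hρ v (Finset.mem_univ v)
  obtain ⟨m, hm, hseq⟩ := (recolorableOn hℓ hℓt (Nat.mul_pos hd hr0) (d - 1) Finset.univ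
    Finset.univ α β (by rw [Finset.card_fin]; omega) hα hβ (by simp) (by simp) (by simp)
    (fun v _ => by
      refine Nat.le_sub_one_of_lt (lt_of_le_of_lt (Finset.card_le_card fun u hu => ?_) (hlate v))
      simpa [mem_laterNeighbors] using hu)).exists_recoloringSeq
  refine ⟨m, ?_, hseq⟩
  calc (m : ℝ) ≤ (9 * (d * r)) ^ (d - 1) * Fintype.card V := by exact_mod_cast hm
    _ ≤ (9 * (d * (c * Real.log (Fintype.card V)))) ^ (d - 1) * Fintype.card V := by gcongr
    _ = _ := by
      rw [show 9 * (d * (c * Real.log (Fintype.card V))) =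
        (9 * d * c) * Real.log (Fintype.card V) by ring, mul_pow]
      ring
end

section
/- Let s ≥ 0 and t ≥ 1 be integers. There is a constant C (depending only on s) with the following property. Let G be a finite simple graph with degree depth (s, t), witnessed by an s-degree partition {V_1, …, V_t}, and let F be a layered subgraph of G with respect to this partition. Then any (s+2)-coloring α of G can be recolored, using only colors 1, …, s+2, to a coloring of G in which color s+2 is not used on F, by a sequence of single-vertex recolorings (each intermediate coloring proper) in which each vertex of F is recolored at most C · (s+1) · 2^{s−1} · t^{s} times and no vertex of G outside F is ever recolored. -/
/-- Number of times vertex `v` is recolored during the first `m` steps of `c`. -/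
def recolorCount {V : Type} {k : ℕ} (c : ℕ → V → Fin k) (m : ℕ) (v : V) : ℕ :=
  ((Finset.range m).filter (fun i => c i v ≠ c (i + 1) v)).card

/-- `P` is an `s`-degree partition of `G` into `t` parts: a partition `{V_1, …, V_t}` of
`V(G)` such that each `V_i` is an `s`-independent set of `G ∖ (V_1 ∪ ⋯ ∪ V_{i-1})`, i.e.
`V_i` is independent and every `v ∈ V_i` has at most `s` neighbors in `V_i ∪ ⋯ ∪ V_t`. -/
def IsDegreePartition {V : Type} (G : SimpleGraph V) (s t : ℕ) (P : Fin t → Set V) : Prop :=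
  (∀ v : V, ∃! i : Fin t, v ∈ P i) ∧
  (∀ i : Fin t, ∀ u ∈ P i, ∀ v ∈ P i, ¬ G.Adj u v) ∧
  (∀ i : Fin t, ∀ v ∈ P i, {u : V | G.Adj v u ∧ ∃ j : Fin t, i ≤ j ∧ u ∈ P j}.ncard ≤ s)

section Recoloring

variable {V : Type} {k : ℕ} {G : SimpleGraph V}

/-- `Recolors G α β N`: the coloring `α` can be transformed into `β` by single-vertex recolorings
through proper colorings, with every vertex `v` recolored at most `N v` times. -/
inductive Recolors (G : SimpleGraph V) (α : V → Fin k) : (V → Fin k) → (V → ℕ) → Prop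
  | refl (N : V → ℕ) : Recolors G α α N
  | step {β γ : V → Fin k} {N N' : V → ℕ} (v : V) (hβ : Recolors G α β N)
      (hγ : ProperColoring G k γ) (hv : β v ≠ γ v) (hne : ∀ u, u ≠ v → γ u = β u)
      (hle : N ≤ N') (hlt : N v + 1 ≤ N' v) : Recolors G α γ N'

namespace Recolors

variable {α β γ : V → Fin k} {M N : V → ℕ}

theorem mono (h : Recolors G α β M) (hMN : M ≤ N) : Recolors G α β N := by
  cases h with
  | refl => exact .refl _
  | step v hβ hγ hv hne hle hlt =>
    exact .step v hβ hγ hv hne (hle.trans hMN) (hlt.trans (hMN v))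

theorem trans (h₁ : Recolors G α β M) (h₂ : Recolors G β γ N) :
    Recolors G α γ (M + N) := by
  induction h₂ with
  | refl N => exact h₁.mono fun v => Nat.le_add_right _ _
  | step v _ hγ hv hne hle hlt ih =>
    refine .step v ih hγ hv hne (fun u => Nat.add_le_add_left (hle u) _) ?_
    simp only [Pi.add_apply]
    omega

theorem proper (h : Recolors G α β N) (hα : ProperColoring G k α) : ProperColoring G k β := by
  cases h with
  | refl => exact hα
  | step _ _ hγ => exact hγ

theorem eq_of_eq_zero (h : Recolors G α β N) {v : V} (hv : N v = 0) : β v = α v := by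
  induction h with
  | refl => rfl
  | step w _ _ _ hne hle hlt ih =>
    have hvw : v ≠ w := by
      rintro rfl
      omega
    rw [hne v hvw]
    exact ih (Nat.le_zero.1 (hv ▸ hle v))

/-- An independent set none of whose neighbors has color `i` can be given color `i`. -/
theorem of_independent [Finite V] (hα : ProperColoring G k α) {i : Fin k} {X : Set V}
    (hX : ∀ v ∈ X, ∀ u ∈ X, ¬ G.Adj v u) (hi : ∀ v ∈ X, ∀ u, G.Adj v u → α u ≠ i) :
    ∃ β, Recolors G α β (X.indicator 1) ∧ (∀ v ∈ X, β v = i) ∧ ∀ v ∉ X, β v = α v := by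
  classical
  induction X, X.toFinite using Set.Finite.induction_on with
  | empty => exact ⟨α, .refl _, by simp, by simp⟩
  | @insert a X ha _ ih =>
    obtain ⟨β, hβ, h₁, h₂⟩ := ih (fun v hv u hu => hX v (.inr hv) u (.inr hu))
      (fun v hv => hi v (.inr hv))
    have hle : (X.indicator 1 : V → ℕ) ≤ (insert a X).indicator 1 := fun v =>
      Set.indicator_le_indicator_of_subset (Set.subset_insert _ _) (by simp) v
    by_cases hai : β a = i
    · refine ⟨β, hβ.mono hle, ?_, fun v hv => h₂ v fun h => hv (.inr h)⟩
      rintro v (rfl | hv)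
      exacts [hai, h₁ v hv]
    · have hnb : ∀ u, G.Adj a u → β u ≠ i := fun u hu => by
        rw [h₂ u fun h => hX a (.inl rfl) u (.inr h) hu]
        exact hi a (.inl rfl) u hu
      refine ⟨Function.update β a i, .step a hβ ?_ (by simpa using hai)
        (fun u hu => by simp [hu]) hle (by simp [ha]), ?_, ?_⟩
      · intro u v huv
        have hβp := hβ.proper hα
        by_cases hu : u = a
        · subst hu
          rw [Function.update_self, Function.update_of_ne huv.ne']
          exact (hnb v huv).symm
        · rw [Function.update_of_ne hu]
          by_cases hv : v = a
          · subst hv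
            rw [Function.update_self]
            exact hnb u huv.symm
          · rw [Function.update_of_ne hv]
            exact hβp huv
      · rintro v (rfl | hv)
        · simp
        · rw [Function.update_of_ne (by rintro rfl; exact ha hv)]
          exact h₁ v hv
      · intro v hv
        rw [Function.update_of_ne (fun h => hv (.inl h))]
        exact h₂ v fun h => hv (.inr h)

theorem exists_recoloringSeq (h : Recolors G α β N) (hα : ProperColoring G k α) :
    ∃ (m : ℕ) (c : ℕ → V → Fin k), c 0 = α ∧ c m = β ∧ RecoloringSeq G k m c ∧
      ∀ v, recolorCount c m v ≤ N v := by
  classical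
  induction h with
  | refl N =>
    exact ⟨0, fun _ => α, rfl, rfl, ⟨fun _ _ => hα, by simp⟩, by simp [recolorCount]⟩
  | @step β γ N N' w _ hγ hw hne hle hlt ih =>
    obtain ⟨m, c, h0, hm, ⟨hc, hd⟩, hN⟩ := ih
    refine ⟨m + 1, fun j => if j ≤ m then c j else γ, by simpa using h0, by simp, ⟨?_, ?_⟩, ?_⟩
    · intro j _
      by_cases hj : j ≤ m
      · simpa [hj] using hc j hj
      · simpa [hj] using hγ
    · intro j hj
      rcases Nat.lt_succ_iff_lt_or_eq.1 hj with hj | rfl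
      · simpa [hj.le, Nat.succ_le_of_lt hj] using hd j hj
      · simp only [le_refl, if_true, Nat.not_succ_le_self, if_false, hm]
        exact ⟨w, hw, fun u hu => by_contra fun h => hu (hne u h).symm⟩
    · intro v
      have hcount : recolorCount (fun j => if j ≤ m then c j else γ) (m + 1) v
          = recolorCount c m v + if β v ≠ γ v then 1 else 0 := by
        simp only [recolorCount, Finset.card_filter, Finset.sum_range_succ]
        congr 1
        · refine Finset.sum_congr rfl fun j hj => ?_
          have hj := Finset.mem_range.1 hj
          simp [hj.le, Nat.succ_le_of_lt hj]
        · simp [hm]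
      rw [hcount]
      by_cases hv : v = w
      · subst hv
        have := hN v
        exact (Nat.add_le_add this (ite_le_one le_rfl zero_le_one)).trans hlt
      · rw [if_neg (by simp [hne v hv])]
        exact (hN v).trans (hle v)

end Recolors

/-- `α` is a proper coloring using only colors of `K` on `F`, the levels of `ℓ` are independent in
`F`, and every vertex of `F` has at most `d` neighbors that are either higher in `F`, or outside
`F` with a color in `K`. -/
structure IsLayered (G : SimpleGraph V) (ℓ : V → ℕ) (F : Set V) (K : Finset (Fin k))
    (α : V → Fin k) (d : ℕ) : Prop where
  proper : ProperColoring G k α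
  mem : ∀ v ∈ F, α v ∈ K
  ne : ∀ v ∈ F, ∀ u ∈ F, G.Adj v u → ℓ v ≠ ℓ u
  ncard_le : ∀ v ∈ F, {u | G.Adj v u ∧ (u ∉ F ∧ α u ∈ K ∨ u ∈ F ∧ ℓ v < ℓ u)}.ncard ≤ d

variable {ℓ : V → ℕ} {F : Set V} {K : Finset (Fin k)} {α β : V → Fin k} {d : ℕ}

theorem IsLayered.congr (h : IsLayered G ℓ F K α d) (hβ : ProperColoring G k β)
    (hmem : ∀ v ∈ F, β v ∈ K) (hout : ∀ v ∉ F, β v ∈ K ↔ α v ∈ K) :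
    IsLayered G ℓ F K β d := by
  refine ⟨hβ, hmem, h.ne, fun v hv => ?_⟩
  convert h.ncard_le v hv using 5 with u
  exact or_congr_left (and_congr_right fun hu => hout u hu)

theorem IsLayered.below [Finite V] (h : IsLayered G ℓ F K α d) (n : ℕ) :
    IsLayered G ℓ {v | v ∈ F ∧ ℓ v < n} K α d := by
  refine ⟨h.proper, fun v hv => h.mem v hv.1, fun v hv u hu => h.ne v hv.1 u hu.1,
    fun v hv => (Set.ncard_le_ncard ?_ (Set.toFinite _)).trans (h.ncard_le v hv.1)⟩
  rintro u ⟨huv, hu | hu⟩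
  · refine ⟨huv, ?_⟩
    by_cases huF : u ∈ F
    · exact .inr ⟨huF, hv.2.trans_le (not_lt.1 fun hn => hu.1 ⟨huF, hn⟩)⟩
    · exact .inl ⟨huF, hu.2⟩
  · exact ⟨huv, .inr ⟨hu.1.1, hu.2⟩⟩

theorem exists_pred_iff_forall_higher [Finite V] (G : SimpleGraph V) (ℓ : V → ℕ)
    (Q : V → Prop) :
    ∃ X : Set V, ∀ v, v ∈ X ↔ Q v ∧ ∀ u, G.Adj v u → ℓ v < ℓ u → u ∉ X := by
  let r : V → V → Prop := fun u v => ℓ v < ℓ u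
  have : IsTrans V r := ⟨fun _ _ _ h₁ h₂ => lt_trans h₂ h₁⟩
  have : Std.Irrefl r := ⟨fun _ => lt_irrefl _⟩
  have wf : WellFounded r := Finite.wellFounded_of_trans_of_irrefl r
  refine ⟨{v | wf.fix (fun v p => Q v ∧ ∀ u, G.Adj v u → ∀ h : ℓ v < ℓ u, ¬ p u h) v},
    fun v => ?_⟩
  rw [Set.mem_ofPred_eq, wf.fix_eq]
  rfl

/-- A color unused on `F` can be added greedily, from the highest level down, until every vertex of
`F` has this color or has it on a neighbor that is higher or outside `F`. -/
theorem IsLayered.exists_full [Finite V] (h : IsLayered G ℓ F K α d) {z : Fin k}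
    (hz : ∀ v ∈ F, α v ≠ z) :
    ∃ β, Recolors G α β (F.indicator 1) ∧ (∀ v ∈ F, β v = α v ∨ β v = z) ∧
      ∀ v ∈ F, β v ≠ z → ∃ u, G.Adj v u ∧ β u = z ∧ (u ∈ F → ℓ v < ℓ u) := by
  obtain ⟨X, hX⟩ := exists_pred_iff_forall_higher G ℓ
    (fun v => v ∈ F ∧ ∀ u, G.Adj v u → α u ≠ z)
  have hXF : X ⊆ F := fun v hv => ((hX v).1 hv).1.1
  obtain ⟨β, hβ, h₁, h₂⟩ := Recolors.of_independent h.proper (i := z) (X := X) (by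
    intro v hv u hu huv
    rcases lt_or_gt_of_ne (h.ne v (hXF hv) u (hXF hu) huv) with hl | hl
    · exact ((hX v).1 hv).2 u huv hl hu
    · exact ((hX u).1 hu).2 v huv.symm hl hv) (fun v hv => ((hX v).1 hv).1.2)
  refine ⟨β, hβ.mono fun v => Set.indicator_le_indicator_of_subset hXF (by simp) v,
    fun v _ => ?_, fun v hv hvz => ?_⟩
  · by_cases hv : v ∈ X
    exacts [.inr (h₁ v hv), .inl (h₂ v hv)]
  · have hvX : v ∉ X := fun hv => hvz (h₁ v hv)
    rw [hX] at hvX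
    by_cases hn : ∀ u, G.Adj v u → α u ≠ z
    · simp only [hv, true_and, not_and, not_forall, not_not] at hvX
      obtain ⟨u, huv, hl, hu⟩ := hvX hn
      exact ⟨u, huv, h₁ u hu, fun _ => hl⟩
    · simp only [not_forall, not_not] at hn
      obtain ⟨u, huv, hu⟩ := hn
      have huF : u ∉ F := fun h => hz u h hu
      exact ⟨u, huv, by rw [h₂ u fun h => huF (hXF h), hu], fun h => absurd h huF⟩

/-- Any color of a palette of `s + 2` colors can be eliminated from a layered set of degree `s`
whose levels are all below `b`, recoloring each of its vertices at most `f` times. -/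
def CanEliminate (G : SimpleGraph V) (k : ℕ) (ℓ : V → ℕ) (b s f : ℕ) : Prop :=
  ∀ (F : Set V) (K : Finset (Fin k)) (α : V → Fin k) (z : Fin k), (∀ v ∈ F, ℓ v < b) →
    IsLayered G ℓ F K α s → K.card = s + 2 → z ∈ K →
    ∃ β, Recolors G α β (F.indicator fun _ => f) ∧ ∀ v ∈ F, β v ∈ K ∧ β v ≠ z

theorem canEliminate_zero [Finite V] (G : SimpleGraph V) (k : ℕ) (ℓ : V → ℕ) (b : ℕ) :
    CanEliminate G k ℓ b 0 1 := by
  intro F K α z _ h hK hz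
  obtain ⟨i, hi, hiz⟩ := Finset.exists_mem_ne (by omega : 1 < K.card) z
  have hno : ∀ v ∈ F, ∀ u, G.Adj v u → ¬ (u ∉ F ∧ α u ∈ K ∨ u ∈ F ∧ ℓ v < ℓ u) := by
    intro v hv u huv hu
    have := (Set.ncard_eq_zero (Set.toFinite _)).1 (Nat.le_zero.1 (h.ncard_le v hv))
    exact this.subset ⟨huv, hu⟩
  have hout : ∀ v ∈ F, ∀ u, G.Adj v u → u ∉ F := by
    intro v hv u huv hu
    rcases lt_or_gt_of_ne (h.ne v hv u hu huv) with hl | hl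
    · exact hno v hv u huv (.inr ⟨hu, hl⟩)
    · exact hno u hu v huv.symm (.inr ⟨hv, hl⟩)
  obtain ⟨β, hβ, h₁, -⟩ := Recolors.of_independent h.proper (i := i) (X := F)
    (fun v hv u hu huv => hout v hv u huv hu)
    (fun v hv u huv hu => hno v hv u huv (.inl ⟨hout v hv u huv, hu ▸ hi⟩))
  exact ⟨β, hβ, fun v hv => h₁ v hv ▸ ⟨hi, hiz⟩⟩

theorem recolors_indicator_eq {f : ℕ} {F : Set V} (h : Recolors G α β (F.indicator fun _ => f))
    {v : V} (hv : v ∉ F) : β v = α v :=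
  h.eq_of_eq_zero (Set.indicator_of_notMem hv _)

/-- If the color `z` is unused on `F`, then it can be traded for the color `i`. -/
theorem CanEliminate.exists_swap [Finite V] {b s f : ℕ} (hf : CanEliminate G k ℓ b s f)
    (hb : ∀ v ∈ F, ℓ v < b) (h : IsLayered G ℓ F K α (s + 1)) (hK : K.card = s + 3)
    {z i : Fin k} (hzK : z ∈ K) (hi : i ∈ K) (hiz : i ≠ z) (hz : ∀ v ∈ F, α v ≠ z) :
    ∃ β, Recolors G α β (F.indicator fun _ => f + 1) ∧ ∀ v ∈ F, β v ∈ K ∧ β v ≠ i := by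
  obtain ⟨β, hβ, hβz, hfull⟩ := h.exists_full hz
  have hout : ∀ v ∉ F, β v = α v := fun v hv => recolors_indicator_eq hβ hv
  have hβK : ∀ v ∈ F, β v ∈ K := fun v hv => by
    rcases hβz v hv with h' | h' <;> rw [h']
    exacts [h.mem v hv, hzK]
  have hlay : IsLayered G ℓ {v | v ∈ F ∧ β v ≠ z} (K.erase z) β s := by
    refine ⟨hβ.proper h.proper, fun v hv => Finset.mem_erase.2 ⟨hv.2, hβK v hv.1⟩,
      fun v hv u hu => h.ne v hv.1 u hu.1, fun v hv => ?_⟩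
    obtain ⟨w, hvw, hw, hwF⟩ := hfull v hv.1 hv.2
    refine Nat.le_of_lt_succ ((Set.ncard_lt_ncard ?_ (Set.toFinite _)).trans_le
      (h.ncard_le v hv.1))
    refine (Set.ssubset_iff_of_subset ?_).2 ⟨w, ⟨hvw, ?_⟩, ?_⟩
    · rintro u ⟨huv, ⟨hu, huK⟩ | ⟨hu, hl⟩⟩
      · rw [Finset.mem_erase] at huK
        have huF : u ∉ F := fun h => hu ⟨h, huK.1⟩
        exact ⟨huv, .inl ⟨huF, hout u huF ▸ huK.2⟩⟩
      · exact ⟨huv, .inr ⟨hu.1, hl⟩⟩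
    · by_cases hwF' : w ∈ F
      · exact .inr ⟨hwF', hwF hwF'⟩
      · exact .inl ⟨hwF', by rw [← hout w hwF', hw]; exact hzK⟩
    · rintro ⟨-, ⟨-, h'⟩ | ⟨h', -⟩⟩
      · exact (Finset.mem_erase.1 h').1 hw
      · exact h'.2 hw
  obtain ⟨γ, hγ, hγi⟩ := hf _ (K.erase z) β i (fun v hv => hb v hv.1) hlay
    (by rw [Finset.card_erase_of_mem hzK, hK]; rfl) (Finset.mem_erase.2 ⟨hiz, hi⟩)
  refine ⟨γ, (hβ.trans hγ).mono fun v => ?_, fun v hv => ?_⟩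
  · by_cases hv : v ∈ F <;> by_cases hvz : β v = z <;> simp [hv, hvz, add_comm]
  · by_cases hvz : β v = z
    · rw [recolors_indicator_eq hγ fun h => h.2 hvz, hvz]
      exact ⟨hzK, hiz.symm⟩
    · have := hγi v ⟨hv, hvz⟩
      exact ⟨Finset.mem_of_mem_erase this.1, this.2⟩

/-- A set `Z` outside `F` of vertices colored `z` that see no color `i` outside `F` can be
recolored to `i`, keeping the color `z` unused on `F`. -/
theorem CanEliminate.exists_recolor [Finite V] {b s f : ℕ} (hf : CanEliminate G k ℓ b s f)
    (hb : ∀ v ∈ F, ℓ v < b) (h : IsLayered G ℓ F K α (s + 1)) (hK : K.card = s + 3)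
    {z i : Fin k} (hzK : z ∈ K) (hi : i ∈ K) (hiz : i ≠ z) (hz : ∀ v ∈ F, α v ≠ z)
    {Z : Set V} (hZF : ∀ v ∈ Z, v ∉ F) (hZz : ∀ v ∈ Z, α v = z)
    (hZi : ∀ v ∈ Z, ∀ u ∉ F, G.Adj v u → α u ≠ i) :
    ∃ β, Recolors G α β ((F ∪ Z).indicator fun _ => 2 * f + 2) ∧
      (∀ v ∈ F, β v ∈ K ∧ β v ≠ z) ∧ ∀ v ∈ Z, β v = i := by
  obtain ⟨β, hβ, hβF⟩ := hf.exists_swap hb h hK hzK hi hiz hz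
  have hout : ∀ v ∉ F, β v = α v := fun v hv => recolors_indicator_eq hβ hv
  obtain ⟨γ, hγ, hγ₁, hγ₂⟩ := Recolors.of_independent (hβ.proper h.proper) (i := i) (X := Z)
    (fun v hv u hu huv => h.proper huv (by rw [hZz v hv, hZz u hu]))
    (fun v hv u huv => by
      by_cases hu : u ∈ F
      · exact (hβF u hu).2
      · rw [hout u hu]
        exact hZi v hv u hu huv)
  have hγF : ∀ v ∈ F, γ v = β v := fun v hv => hγ₂ v fun h => hZF v h hv
  have hlay : IsLayered G ℓ F K γ (s + 1) := by
    refine h.congr (hγ.proper (hβ.proper h.proper)) (fun v hv => hγF v hv ▸ (hβF v hv).1) ?_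
    intro v hv
    by_cases hvZ : v ∈ Z
    · simp [hγ₁ v hvZ, hZz v hvZ, hi, hzK]
    · rw [hγ₂ v hvZ, hout v hv]
  obtain ⟨δ, hδ, hδF⟩ := hf.exists_swap hb hlay hK hi hzK hiz.symm
    (fun v hv => hγF v hv ▸ (hβF v hv).2)
  refine ⟨δ, ((hβ.trans hγ).trans hδ).mono fun v => ?_, hδF, fun v hv => ?_⟩
  · by_cases hv : v ∈ F
    · have : v ∉ Z := fun h => hZF v h hv
      simp [hv, this]
      omega
    · by_cases hvZ : v ∈ Z <;> simp [hv, hvZ]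
  · rw [recolors_indicator_eq hδ (hZF v hv), hγ₁ v hv]

/-- If the color `z` is unused below level `n`, then it can be eliminated from level `n` too. -/
theorem CanEliminate.exists_next_level [Finite V] {b s f n : ℕ} (hf : CanEliminate G k ℓ b s f)
    (hn : n < b) (h : IsLayered G ℓ F K α (s + 1)) (hK : K.card = s + 3)
    {z : Fin k} (hzK : z ∈ K) (hz : ∀ v ∈ F, ℓ v < n → α v ≠ z) :
    ∃ β, Recolors G α β ({v | v ∈ F ∧ ℓ v < n + 1}.indicator fun _ => (s + 2) * (2 * f + 2)) ∧
      ∀ v ∈ F, β v ∈ K ∧ (ℓ v < n + 1 → β v ≠ z) := by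
  have key : ∀ A : Finset (Fin k), A ⊆ K.erase z →
      ∃ β, Recolors G α β ({v | v ∈ F ∧ ℓ v < n + 1}.indicator fun _ => A.card * (2 * f + 2)) ∧
        (∀ v ∈ F, β v ∈ K ∧ (ℓ v < n → β v ≠ z)) ∧
        ∀ v ∈ F, ℓ v = n → β v = z → ∀ i ∈ A, ∃ u, ¬ (u ∈ F ∧ ℓ u < n + 1) ∧ G.Adj v u ∧
          α u = i := by
    intro A
    induction A using Finset.induction_on with
    | empty =>
      exact fun _ => ⟨α, .refl _, fun v hv => ⟨h.mem v hv, hz v hv⟩, by simp⟩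
    | @insert i A hiA ih =>
      intro hA
      obtain ⟨β, hβ, hβF, hβA⟩ := ih fun x hx => hA (Finset.mem_insert_of_mem hx)
      obtain ⟨hiz, hi⟩ := Finset.mem_erase.1 (hA (Finset.mem_insert_self i A))
      have hout : ∀ v, ¬ (v ∈ F ∧ ℓ v < n + 1) → β v = α v :=
        fun v hv => recolors_indicator_eq hβ hv
      have hlay : IsLayered G ℓ F K β (s + 1) :=
        h.congr (hβ.proper h.proper) (fun v hv => (hβF v hv).1)
          fun v hv => by rw [hout v fun h => hv h.1]
      obtain ⟨γ, hγ, hγF, hγZ⟩ := hf.exists_recolor (F := {v | v ∈ F ∧ ℓ v < n})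
        (fun v hv => hv.2.trans hn) (hlay.below n) hK hzK hi hiz
        (fun v hv => (hβF v hv.1).2 hv.2)
        (Z := {v | v ∈ F ∧ ℓ v = n ∧ β v = z ∧
          ∀ u, ¬ (u ∈ F ∧ ℓ u < n) → G.Adj v u → β u ≠ i})
        (fun v hv hv' => by
          have := hv'.2
          have := hv.2.1
          omega)
        (fun v hv => hv.2.2.1) (fun v hv => hv.2.2.2)
      refine ⟨γ, (hβ.trans hγ).mono fun v => ?_, fun v hv => ?_, fun v hv hvn hvz => ?_⟩
      · rw [Finset.card_insert_of_notMem hiA, Pi.add_apply]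
        by_cases hv : v ∈ F ∧ ℓ v < n + 1
        · have hv' : v ∈ {v | v ∈ F ∧ ℓ v < n + 1} := hv
          rw [Set.indicator_of_mem hv', Set.indicator_of_mem hv', Nat.succ_mul A.card]
          exact Nat.add_le_add_left (Set.indicator_le_self' (fun _ _ => Nat.zero_le _) v) _
        · have hv' : v ∉ {v | v ∈ F ∧ ℓ v < n + 1} := hv
          rw [Set.indicator_of_notMem hv', Set.indicator_of_notMem hv', Set.indicator_of_notMem]
          · simp
          · rintro (hv' | hv')
            · exact hv ⟨hv'.1, hv'.2.trans (Nat.lt_succ_self n)⟩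
            · exact hv ⟨hv'.1, by rw [hv'.2.1]; exact Nat.lt_succ_self n⟩
      · by_cases hvB : ℓ v < n
        · exact ⟨(hγF v ⟨hv, hvB⟩).1, fun _ => (hγF v ⟨hv, hvB⟩).2⟩
        · refine ⟨?_, fun h => absurd h hvB⟩
          by_cases hvZ : v ∈ {v | v ∈ F ∧ ℓ v = n ∧ β v = z ∧
              ∀ u, ¬ (u ∈ F ∧ ℓ u < n) → G.Adj v u → β u ≠ i}
          · rw [hγZ v hvZ]
            exact hi
          · rw [recolors_indicator_eq hγ (by
              rintro (h' | h')
              exacts [hvB h'.2, hvZ h'])]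
            exact (hβF v hv).1
      · have hvZ : v ∉ {v | v ∈ F ∧ ℓ v = n ∧ β v = z ∧
            ∀ u, ¬ (u ∈ F ∧ ℓ u < n) → G.Adj v u → β u ≠ i} := fun h' =>
          hiz ((hγZ v h').symm.trans hvz)
        have hβv : β v = z := by
          rw [← hvz]
          refine (recolors_indicator_eq hγ ?_).symm
          rintro (h' | h')
          exacts [h'.2.ne hvn, hvZ h']
        intro j hj
        rcases Finset.mem_insert.1 hj with rfl | hj
        · simp only [Set.mem_ofPred_eq, hv, hvn, hβv, true_and, not_forall, not_not] at hvZ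
          obtain ⟨u, hu, huv, huj⟩ := hvZ
          have hu' : ¬ (u ∈ F ∧ ℓ u < n + 1) := by
            rintro ⟨huF, hul⟩
            have h₁ := h.ne v hv u huF huv
            have h₂ : ¬ ℓ u < n := fun h' => hu ⟨huF, h'⟩
            omega
          exact ⟨u, hu', huv, by rw [← hout u hu', huj]⟩
        · exact hβA v hv hvn hβv j hj
  have hcard : (K.erase z).card = s + 2 := by
    rw [Finset.card_erase_of_mem hzK, hK]
    rfl
  obtain ⟨β, hβ, hβF, hβA⟩ := key _ subset_rfl
  rw [hcard] at hβ
  refine ⟨β, hβ, fun v hv => ⟨(hβF v hv).1, fun hvn hvz => ?_⟩⟩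
  rcases Nat.lt_succ_iff_lt_or_eq.1 hvn with hvn | hvn
  · exact (hβF v hv).2 hvn hvz
  have hsub : (↑(K.erase z) : Set (Fin k)) ⊆
      α '' {u | G.Adj v u ∧ (u ∉ F ∧ α u ∈ K ∨ u ∈ F ∧ ℓ v < ℓ u)} := by
    intro i hi
    obtain ⟨u, hu, huv, rfl⟩ := hβA v hv hvn hvz i hi
    refine ⟨u, ⟨huv, ?_⟩, rfl⟩
    by_cases huF : u ∈ F
    · refine .inr ⟨huF, ?_⟩
      have : ¬ ℓ u < n + 1 := fun h' => hu ⟨huF, h'⟩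
      omega
    · exact .inl ⟨huF, Finset.mem_of_mem_erase hi⟩
  have h₁ := Set.ncard_le_ncard hsub (Set.toFinite _)
  rw [Set.ncard_coe_finset, hcard] at h₁
  have h₂ := h₁.trans (Set.ncard_image_le (Set.toFinite _))
  have h₃ := h.ncard_le v hv
  omega

theorem CanEliminate.succ [Finite V] {b s f : ℕ} (hf : CanEliminate G k ℓ b s f) :
    CanEliminate G k ℓ b (s + 1) (b * ((s + 2) * (2 * f + 2))) := by
  intro F K α z hb h hK hzK
  have key : ∀ n ≤ b, ∃ β,
      Recolors G α β (F.indicator fun _ => n * ((s + 2) * (2 * f + 2))) ∧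
        ∀ v ∈ F, β v ∈ K ∧ (ℓ v < n → β v ≠ z) := by
    intro n
    induction n with
    | zero => exact fun _ => ⟨α, .refl _, fun v hv => ⟨h.mem v hv, by simp⟩⟩
    | succ n ih =>
      intro hn
      obtain ⟨β, hβ, hβF⟩ := ih (Nat.le_of_succ_le hn)
      have hlay : IsLayered G ℓ F K β (s + 1) :=
        h.congr (hβ.proper h.proper) (fun v hv => (hβF v hv).1)
          fun v hv => by rw [recolors_indicator_eq hβ hv]
      obtain ⟨γ, hγ, hγF⟩ := hf.exists_next_level hn hlay hK hzK
        (fun v hv => (hβF v hv).2)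
      refine ⟨γ, (hβ.trans hγ).mono fun v => ?_, hγF⟩
      rw [Pi.add_apply]
      by_cases hv : v ∈ F
      · rw [Set.indicator_of_mem hv, Set.indicator_of_mem hv, Nat.succ_mul n]
        exact Nat.add_le_add_left (Set.indicator_le_self' (fun _ _ => Nat.zero_le _) v) _
      · rw [Set.indicator_of_notMem hv, Set.indicator_of_notMem fun h' => hv h'.1]
        simp
  obtain ⟨β, hβ, hβF⟩ := key b le_rfl
  exact ⟨β, hβ, fun v hv => ⟨(hβF v hv).1, (hβF v hv).2 (hb v hv)⟩⟩

theorem CanEliminate.mono {b s f g : ℕ} (hf : CanEliminate G k ℓ b s f) (hfg : f ≤ g) :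
    CanEliminate G k ℓ b s g := fun F K α z hb h hK hz => by
  obtain ⟨β, hβ, hβF⟩ := hf F K α z hb h hK hz
  exact ⟨β, hβ.mono fun _ => Set.indicator_le_indicator hfg, hβF⟩

theorem exists_canEliminate (s : ℕ) : ∃ C : ℕ, ∀ (V : Type) [Finite V] (G : SimpleGraph V)
    (k : ℕ) (ℓ : V → ℕ) (b : ℕ), 1 ≤ b → CanEliminate G k ℓ b s (C * b ^ s) := by
  induction s with
  | zero => exact ⟨1, fun V _ G k ℓ b _ => by simpa using canEliminate_zero G k ℓ b⟩
  | succ s ih =>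
    obtain ⟨C, hC⟩ := ih
    refine ⟨(s + 2) * (2 * C + 2), fun V _ G k ℓ b hb => (hC V G k ℓ b hb).succ.mono ?_⟩
    have : 1 ≤ b ^ s := Nat.one_le_pow _ _ hb
    calc b * ((s + 2) * (2 * (C * b ^ s) + 2))
        ≤ b * ((s + 2) * (2 * (C * b ^ s) + 2 * b ^ s)) := by gcongr; omega
      _ = (s + 2) * (2 * C + 2) * b ^ (s + 1) := by ring

end Recoloring

/-- Let `s ≥ 0`, `t ≥ 1`. There is a constant `C = C(s)` such that for every
finite graph `G` with an `s`-degree partition `{V_1, …, V_t}` and every layered subgraph `F`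
(on the union of the first `b` parts), every `(s+2)`-coloring of `G` can be recolored to a
coloring not using color `s+2` on `F`, recoloring each vertex of `F` at most
`C * (s+1) * 2^(s-1) * t^s` times and never recoloring a vertex outside `F`. -/
theorem statement1 (s : ℕ) :
    ∃ C : ℕ, ∀ (t : ℕ), 1 ≤ t →
      ∀ (V : Type) [Fintype V] [DecidableEq V] (G : SimpleGraph V)
        (P : Fin t → Set V), IsDegreePartition G s t P →
      ∀ (b : ℕ), 1 ≤ b → b ≤ t →
      ∀ F : Set V, F = {v : V | ∃ j : Fin t, (j : ℕ) < b ∧ v ∈ P j} →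
      ∀ α : V → Fin (s + 2), ProperColoring G (s + 2) α →
        ∃ (m : ℕ) (c : ℕ → V → Fin (s + 2)),
          c 0 = α ∧ RecoloringSeq G (s + 2) m c ∧
          (∀ v ∈ F, recolorCount c m v ≤ C * (s + 1) * 2 ^ (s - 1) * t ^ s) ∧
          (∀ v ∉ F, recolorCount c m v = 0) ∧
          (∀ v ∈ F, c m v ≠ Fin.last (s + 1)) := by
  obtain ⟨C, hC⟩ := exists_canEliminate s
  refine ⟨C, fun t ht V _ _ G P hP b hb hbt F hF α hα => ?_⟩
  obtain ⟨hcover, hindep, hdeg⟩ := hP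
  choose ℓ hℓ hℓu using hcover
  have hmem : ∀ v, v ∈ F ↔ (ℓ v : ℕ) < b := by
    intro v
    rw [hF]
    refine ⟨?_, fun h => ⟨ℓ v, h, hℓ v⟩⟩
    rintro ⟨j, hj, hv⟩
    rwa [← hℓu v j hv]
  have hlay : IsLayered G (fun v => (ℓ v : ℕ)) F Finset.univ α s := by
    refine ⟨hα, fun _ _ => Finset.mem_univ _, fun v _ u _ huv h => ?_, fun v hv => ?_⟩
    · refine hindep (ℓ v) v (hℓ v) u ?_ huv
      rw [Fin.ext h]
      exact hℓ u
    · refine (Set.ncard_le_ncard ?_ (Set.toFinite _)).trans (hdeg (ℓ v) v (hℓ v))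
      rintro u ⟨huv, hu | hu⟩ <;> refine ⟨huv, ℓ u, ?_, hℓ u⟩ <;> rw [Fin.le_def]
      · have h₁ := (hmem v).1 hv
        have h₂ := (hmem u).not.1 hu.1
        omega
      · exact hu.2.le
  obtain ⟨β, hβ, hβF⟩ := hC V G (s + 2) (fun v => (ℓ v : ℕ)) b hb F Finset.univ α
    (Fin.last (s + 1)) (fun v hv => (hmem v).1 hv) hlay (by simp) (Finset.mem_univ _)
  obtain ⟨m, c, h0, hm, hc, hcount⟩ := hβ.exists_recoloringSeq hα
  refine ⟨m, c, h0, hc, fun v hv => ?_, fun v hv => ?_, fun v hv => hm ▸ (hβF v hv).2⟩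
  · refine (hcount v).trans ?_
    rw [Set.indicator_of_mem hv]
    have h₁ : C ≤ C * (s + 1) * 2 ^ (s - 1) := by
      rw [mul_assoc]
      exact Nat.le_mul_of_pos_right _ (by positivity)
    gcongr
  · have := hcount v
    rw [Set.indicator_of_notMem hv] at this
    exact Nat.le_zero.1 this
end

section
/- Let s ≥ 1 and t ≥ 1 be integers and let G be a graph with s-degree partition {V_1, …, V_t}. Suppose S ⊆ V(G) is an independent set of G such that every vertex u ∈ V(G) ∖ S with u ∈ V_p has a neighbor u' ∈ S with u' ∈ V_q for some q > p. Then the induced subgraph H = G − S has degree depth (s − 1, t), witnessed by the partition {V_1 ∖ S, …, V_t ∖ S} (discarding empty parts as needed). -/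
/-- `P` is an `s`-degree partition of the induced subgraph of `G` on the vertex set `A`:
the parts partition `A`, each part is independent, and every `v ∈ P i` has at most `s`
neighbors inside `A` lying in parts `P j` with `j ≥ i`. -/
def IsDegreePartitionOn {V : Type} (G : SimpleGraph V) (A : Set V) (s t : ℕ)
    (P : Fin t → Set V) : Prop :=
  (∀ v ∈ A, ∃! i : Fin t, v ∈ P i) ∧
  (∀ i : Fin t, P i ⊆ A) ∧
  (∀ i : Fin t, ∀ u ∈ P i, ∀ v ∈ P i, ¬ G.Adj u v) ∧
  (∀ i : Fin t, ∀ v ∈ P i,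
    {u : V | u ∈ A ∧ G.Adj v u ∧ ∃ j : Fin t, i ≤ j ∧ u ∈ P j}.ncard ≤ s)

/-- the Subclaim. If `G` has an `s`-degree partition `{V_1, …, V_t}`
(`s, t ≥ 1`) and `S` is an independent set such that every vertex `u ∉ S` lying in part `V_p`
has a neighbor in `S` lying in a strictly later part, then `H = G − S` has degree depth
`(s − 1, t)`, witnessed by the partition `{V_1 ∖ S, …, V_t ∖ S}`. -/
theorem statement3 (s t : ℕ) (hs : 1 ≤ s) (ht : 1 ≤ t)
    (V : Type) [Fintype V] [DecidableEq V] (G : SimpleGraph V)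
    (P : Fin t → Set V) (hP : IsDegreePartition G s t P)
    (S : Set V)
    (hSind : ∀ u ∈ S, ∀ v ∈ S, ¬ G.Adj u v)
    (hS : ∀ u : V, u ∉ S → ∀ p : Fin t, u ∈ P p →
      ∃ u' ∈ S, G.Adj u u' ∧ ∃ q : Fin t, p < q ∧ u' ∈ P q) :
    IsDegreePartitionOn G Sᶜ (s - 1) t (fun i => P i \ S) := by
  obtain ⟨hpart, hindep, hdeg⟩ := hP
  refine ⟨fun v hv => ?_, fun i v hv => hv.2,
    fun i u hu v hv => hindep i u hu.1 v hv.1, fun i v hv => ?_⟩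
  · obtain ⟨i, hi, huniq⟩ := hpart v
    exact ⟨i, ⟨hi, hv⟩, fun j hj => huniq j hj.1⟩
  · obtain ⟨w, hwS, hvw, q, hiq, hwq⟩ := hS v hv.2 i hv.1
    refine Nat.le_sub_one_of_lt (lt_of_lt_of_le (Set.ncard_lt_ncard ?_ (Set.toFinite _))
      (hdeg i v hv.1))
    refine (Set.ssubset_iff_of_subset ?_).2 ⟨w, ⟨hvw, q, hiq.le, hwq⟩, fun h => h.1 hwS⟩
    rintro u ⟨-, hvu, j, hij, hu⟩
    exact ⟨hvu, j, hij, hu.1⟩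
end

section
/- Let s ≥ 0 and t ≥ 1 be integers. There exists a constant C (depending only on s) such that for every finite simple graph G with n vertices and degree depth (s, t), the reconfiguration graph R_{s+2}(G) of (s+2)-colorings of G is connected and has diameter at most C · n · s · (2t)^{s} (and at most C · n when s = 0). -/
section Recoloring

variable {V : Type} {G : SimpleGraph V} {q : ℕ}

/-- The reconfiguration graph on all colorings; the improper ones are isolated. -/
def recolorGraph (G : SimpleGraph V) (q : ℕ) : SimpleGraph (V → Fin q) where
  Adj f g := ProperColoring G q f ∧ ProperColoring G q g ∧ DiffersAtExactlyOne f g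
  symm := ⟨fun _ _ ⟨hf, hg, h⟩ => ⟨hg, hf, by simpa only [DiffersAtExactlyOne, ne_comm] using h⟩⟩
  loopless := ⟨fun _ ⟨_, _, _, h, _⟩ => h rfl⟩

/-- `β` can be reached from `α` by at most `m` recolorings. -/
def Near (G : SimpleGraph V) (m : ℕ) (α β : V → Fin q) : Prop :=
  ∃ w : (recolorGraph G q).Walk α β, w.length ≤ m

theorem Near.refl (m : ℕ) (α : V → Fin q) : Near G m α α := ⟨.nil, by simp⟩

theorem Near.symm {m : ℕ} {α β : V → Fin q} (h : Near G m α β) : Near G m β α := by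
  obtain ⟨w, hw⟩ := h
  exact ⟨w.reverse, by simpa using hw⟩

theorem Near.trans {m m' : ℕ} {α β γ : V → Fin q} (h : Near G m α β) (h' : Near G m' β γ) :
    Near G (m + m') α γ := by
  obtain ⟨w, hw⟩ := h
  obtain ⟨w', hw'⟩ := h'
  exact ⟨w.append w', by rw [SimpleGraph.Walk.length_append]; omega⟩

theorem Near.mono {m m' : ℕ} {α β : V → Fin q} (h : Near G m α β) (hm : m ≤ m') :
    Near G m' α β := by
  obtain ⟨w, hw⟩ := h
  exact ⟨w, hw.trans hm⟩

theorem Near.exists_recoloringSeq {m : ℕ} {α β : V → Fin q} (h : Near G m α β)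
    (hα : ProperColoring G q α) :
    ∃ m' ≤ m, ∃ c : ℕ → V → Fin q, c 0 = α ∧ c m' = β ∧ RecoloringSeq G q m' c := by
  obtain ⟨w, hw⟩ := h
  refine ⟨w.length, hw, w.getVert, w.getVert_zero, w.getVert_length, fun i hi => ?_,
    fun i hi => (w.adj_getVert_succ hi).2.2⟩
  cases i with
  | zero => simpa using hα
  | succ i => exact (w.adj_getVert_succ hi).2.1

/-- The vertices on which two colorings differ can be recolored one by one if they form an
independent set. -/
theorem near_of_independent [Fintype V] {α β : V → Fin q} (hα : ProperColoring G q α)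
    (hβ : ProperColoring G q β) (h : ∀ u v, G.Adj u v → α u = β u ∨ α v = β v) :
    Near G (Fintype.card V) α β := by
  classical
  suffices H : ∀ (d : ℕ) (α : V → Fin q), ProperColoring G q α →
      (∀ u v, G.Adj u v → α u = β u ∨ α v = β v) →
      (Finset.univ.filter fun v => α v ≠ β v).card = d → Near G d α β from
    (H _ α hα h rfl).mono (Finset.card_le_univ _)
  intro d
  induction d with
  | zero =>
    intro α _ _ hd
    have : α = β := by
      funext v
      by_contra hv
      have : v ∈ (Finset.univ.filter fun v => α v ≠ β v) := by simpa using hv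
      rw [Finset.card_eq_zero.mp hd] at this
      simp at this
    subst this
    exact Near.refl _ _
  | succ d ih =>
    intro α hα h hd
    have hpos : 0 < (Finset.univ.filter fun v => α v ≠ β v).card := by omega
    obtain ⟨v, hv⟩ := Finset.card_pos.mp hpos
    have hvne : α v ≠ β v := by simpa using hv
    have hup : ∀ u, u ≠ v → Function.update α v (β v) u = α u :=
      fun u hu => Function.update_of_ne hu _ _
    have hself : Function.update α v (β v) v = β v := Function.update_self ..
    have hα' : ProperColoring G q (Function.update α v (β v)) := by
      intro x y hxy
      by_cases hx : x = v
      · subst hx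
        rw [hself, hup y hxy.ne', (h x y hxy).resolve_left hvne]
        exact hβ hxy
      · by_cases hy : y = v
        · subst hy
          rw [hself, hup x hx, (h x y hxy).resolve_right hvne]
          exact hβ hxy
        · rw [hup x hx, hup y hy]
          exact hα hxy
    have hadj : (recolorGraph G q).Adj α (Function.update α v (β v)) := by
      refine ⟨hα, hα', v, ?_, fun u hu => ?_⟩
      · simpa [hself] using hvne
      · by_contra huv
        exact hu (hup u huv).symm
    have hstep : Near G 1 α (Function.update α v (β v)) := ⟨hadj.toWalk, by simp⟩
    rw [add_comm]
    refine hstep.trans (ih _ hα' (fun x y hxy => ?_) ?_)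
    · by_cases hx : x = v
      · exact .inl (hx ▸ hself)
      · by_cases hy : y = v
        · exact .inr (hy ▸ hself)
        · rw [hup x hx, hup y hy]
          exact h x y hxy
    · have : (Finset.univ.filter fun u => Function.update α v (β v) u ≠ β u) =
          (Finset.univ.filter fun u => α u ≠ β u).erase v := by
        ext u
        by_cases hu : u = v
        · simp [hu]
        · simp [hu]
      rw [this, Finset.card_erase_of_mem hv, hd, Nat.add_sub_cancel]

theorem near_of_differ_color [Fintype V] {α β : V → Fin q} (hα : ProperColoring G q α)
    (hβ : ProperColoring G q β) (k : Fin q) (h : ∀ v, α v ≠ β v → α v = k) :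
    Near G (Fintype.card V) α β := by
  refine near_of_independent hα hβ fun u v huv => ?_
  by_contra! hne
  exact hα huv ((h u hne.1).trans (h v hne.2).symm)

/-- Recursion along decreasing rank, for a relation instead of a function. -/
theorem exists_forall_of_rank [Finite V] {κ : Type} [Nonempty κ] (r : V → ℕ)
    (P : V → (V → κ) → κ → Prop)
    (hP : ∀ v f g c, (∀ u, r v < r u → f u = g u) → P v f c → P v g c)
    (hex : ∀ v f, ∃ c, P v f c) : ∃ f, ∀ v, P v f (f v) := by
  classical
  have wf : WellFounded fun u v => r v < r u := by
    have : IsTrans V fun u v => r v < r u := ⟨fun _ _ _ h h' => h'.trans h⟩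
    have : Std.Irrefl fun u v : V => r v < r u := ⟨fun _ => lt_irrefl _⟩
    exact Finite.wellFounded_of_trans_of_irrefl _
  choose F hF using hex
  let ext (v : V) (g : ∀ u, r v < r u → κ) : V → κ := fun u =>
    if h : r v < r u then g u h else Classical.arbitrary κ
  let f : V → κ := wf.fix fun v g => F v (ext v g)
  refine ⟨f, fun v => hP v (ext v fun u _ => f u) f _ (fun u hu => by simp [ext, hu]) ?_⟩
  have : f v = F v (ext v fun u _ => f u) := wf.fix_eq _ v
  rw [this]
  exact hF _ _

/-- The set of neighbors of higher rank whose color lies in `K`. -/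
def upNeighbors (G : SimpleGraph V) (r : V → ℕ) (K : Finset (Fin q)) (α : V → Fin q) (v : V) :
    Set V :=
  {u | G.Adj v u ∧ r v < r u ∧ α u ∈ K}

/-- `α` and `β` differ only on vertices of rank less than `j`, with colors in `K`. -/
def AgreeOff (r : V → ℕ) (K : Finset (Fin q)) (j : ℕ) (α β : V → Fin q) : Prop :=
  ∀ v, α v = β v ∨ (α v ∈ K ∧ β v ∈ K ∧ r v < j)

/-- Vertices of rank less than `j` with colors in `K` have at most `s` upper neighbors. -/
def UpDegreeLE (G : SimpleGraph V) (r : V → ℕ) (s : ℕ) (K : Finset (Fin q)) (j : ℕ)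
    (α : V → Fin q) : Prop :=
  ∀ v, α v ∈ K → r v < j → (upNeighbors G r K α v).ncard ≤ s

theorem AgreeOff.mem_iff {r : V → ℕ} {K : Finset (Fin q)} {j : ℕ} {α β : V → Fin q}
    (h : AgreeOff r K j α β) (v : V) : α v ∈ K ↔ β v ∈ K := by
  rcases h v with h | h
  · rw [h]
  · tauto

theorem AgreeOff.trans {r : V → ℕ} {K : Finset (Fin q)} {j : ℕ} {α β γ : V → Fin q}
    (h : AgreeOff r K j α β) (h' : AgreeOff r K j β γ) : AgreeOff r K j α γ := by
  intro v
  have h₁ := h v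
  have h₂ := h' v
  grind

theorem AgreeOff.symm {r : V → ℕ} {K : Finset (Fin q)} {j : ℕ} {α β : V → Fin q}
    (h : AgreeOff r K j α β) : AgreeOff r K j β α := by
  intro v
  have h₁ := h v
  grind

theorem AgreeOff.mono {r : V → ℕ} {K : Finset (Fin q)} {i j : ℕ} {α β : V → Fin q}
    (h : AgreeOff r K i α β) (hij : i ≤ j) : AgreeOff r K j α β := by
  intro v
  have h₁ := h v
  grind

theorem UpDegreeLE.of_mem_iff {r : V → ℕ} {s : ℕ} {K : Finset (Fin q)} {j : ℕ}
    {α β : V → Fin q} (h : UpDegreeLE G r s K j α) (hm : ∀ v, α v ∈ K ↔ β v ∈ K) :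
    UpDegreeLE G r s K j β := by
  intro v hv hj
  simpa only [upNeighbors, hm] using h v ((hm v).2 hv) hj

theorem exists_greedy_coloring [Finite V] {r : V → ℕ} (hr : ∀ u v, G.Adj u v → r u ≠ r v)
    {K K' : Finset (Fin q)} (hK : K' ⊆ K) {α : V → Fin q} (hα : ProperColoring G q α)
    (B : Set V) (hB : ∀ v ∈ B, α v ∈ K ∧ (upNeighbors G r K α v).ncard < K'.card)
    (hup : ∀ u v, G.Adj u v → r u < r v → α u ∈ K → v ∈ B → u ∈ B) :
    ∃ γ : V → Fin q, ProperColoring G q γ ∧ (∀ v ∉ B, γ v = α v) ∧ ∀ v ∈ B, γ v ∈ K' := by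
  classical
  rcases isEmpty_or_nonempty V with hV | ⟨⟨v₀⟩⟩
  · exact ⟨α, hα, fun _ _ => rfl, fun v => (hV.false v).elim⟩
  have : Nonempty (Fin q) := ⟨α v₀⟩
  obtain ⟨γ, hγ⟩ := exists_forall_of_rank r
    (fun v f c => (v ∈ B → c ∈ K' ∧ ∀ u ∈ upNeighbors G r K α v, f u ≠ c) ∧ (v ∉ B → c = α v))
    (fun v f g c hfg h => ⟨fun hv => ⟨(h.1 hv).1, fun u hu => hfg u hu.2.1 ▸ (h.1 hv).2 u hu⟩,
      h.2⟩)
    (fun v f => by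
      by_cases hv : v ∈ B
      · have hlt : (f '' upNeighbors G r K α v).ncard < (K' : Set (Fin q)).ncard := by
          rw [Set.ncard_coe_finset]
          exact (Set.ncard_image_le (Set.toFinite _)).trans_lt (hB v hv).2
        obtain ⟨c, hc, hc'⟩ := Set.exists_mem_notMem_of_ncard_lt_ncard hlt
        exact ⟨c, fun _ => ⟨hc, fun u hu huc => hc' ⟨u, hu, huc⟩⟩, fun h => (h hv).elim⟩
      · exact ⟨α v, fun h => (hv h).elim, fun _ => rfl⟩)
  refine ⟨γ, ?_, fun v hv => (hγ v).2 hv, fun v hv => ((hγ v).1 hv).1⟩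
  have key : ∀ u v, G.Adj u v → r u < r v → γ u ≠ γ v := by
    intro u v huv hlt
    have hu := hγ u
    have hv := hγ v
    have hp := hα huv
    by_cases hvK : α v ∈ K
    · by_cases huB : u ∈ B
      · exact ((hu.1 huB).2 v ⟨huv, hlt, hvK⟩).symm
      · by_cases hvB : v ∈ B
        · have huK : α u ∉ K := fun h => huB (hup u v huv hlt h hvB)
          intro h
          exact huK (hu.2 huB ▸ h ▸ hK (hv.1 hvB).1)
        · rwa [hu.2 huB, hv.2 hvB]
    · have hvB : v ∉ B := fun h => hvK (hB v h).1
      rw [hv.2 hvB]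
      by_cases huB : u ∈ B
      · exact fun h => hvK (h ▸ hK (hu.1 huB).1)
      · rwa [hu.2 huB]
  intro u v huv
  rcases (hr u v huv).lt_or_gt with h | h
  · exact key u v huv h
  · exact (key v u huv.symm h).symm

/-- Greedy choice of an independent subset of `A`, by decreasing rank, avoiding vertices with
an upper neighbor in `X`. -/
theorem exists_kernel [Finite V] (G : SimpleGraph V) (r : V → ℕ) (A X : Set V) :
    ∃ S : Set V, ∀ v, v ∈ S ↔
      v ∈ A ∧ ∀ u, G.Adj v u → r v < r u → u ∉ X ∧ u ∉ S := by
  obtain ⟨f, hf⟩ := exists_forall_of_rank (κ := Prop) r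
    (fun v f c => c ↔ v ∈ A ∧ ∀ u, G.Adj v u → r v < r u → u ∉ X ∧ ¬ f u)
    (fun v f g c hfg h => h.trans (and_congr_right fun _ => forall_congr' fun u =>
      forall_congr' fun _ => forall_congr' fun hu => by rw [hfg u hu]))
    (fun v f => ⟨_, Iff.rfl⟩)
  exact ⟨{v | f v}, hf⟩

open Classical in
/-- Give color `k` to all vertices of `S`. -/
noncomputable def recolorSet (S : Set V) (k : Fin q) (α : V → Fin q) : V → Fin q :=
  fun v => if v ∈ S then k else α v

section Kernel

variable {r : V → ℕ} {K : Finset (Fin q)} {k : Fin q} {i : ℕ} {α : V → Fin q} {S X : Set V}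

theorem properColoring_recolorSet (hr : ∀ u v, G.Adj u v → r u ≠ r v)
    (hα : ProperColoring G q α) (hk : ∀ v, r v < i → α v ≠ k) (hX : ∀ v, v ∈ X ↔ α v = k)
    (hS : ∀ v, v ∈ S ↔ (α v ∈ K ∧ r v < i) ∧ ∀ u, G.Adj v u → r v < r u → u ∉ X ∧ u ∉ S) :
    ProperColoring G q (recolorSet S k α) := by
  have key : ∀ u v, G.Adj u v → u ∈ S → v ∉ S ∧ α v ≠ k := by
    intro u v huv hu
    have h₁ := (hS u).1 hu
    rcases (hr u v huv).lt_or_gt with h | h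
    · have := h₁.2 v huv h
      exact ⟨this.2, fun h' => this.1 ((hX v).2 h')⟩
    · exact ⟨fun hv => (((hS v).1 hv).2 u huv.symm h).2 hu, hk v (h.trans h₁.1.2)⟩
  intro u v huv
  have h₁ := key u v huv
  have h₂ := key v u huv.symm
  have h₃ := hα huv
  unfold recolorSet
  grind

theorem near_recolorSet [Fintype V] (hα : ProperColoring G q α)
    (hS : ProperColoring G q (recolorSet S k α)) :
    Near G (Fintype.card V) α (recolorSet S k α) := by
  refine (near_of_differ_color hS hα k fun v hv => ?_).symm
  unfold recolorSet at *
  grind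

theorem upDegreeLE_recolorSet [Finite V] {s : ℕ} (hkK : k ∈ K)
    (hX : ∀ v, v ∈ X ↔ α v = k)
    (hS : ∀ v, v ∈ S ↔ (α v ∈ K ∧ r v < i) ∧ ∀ u, G.Adj v u → r v < r u → u ∉ X ∧ u ∉ S)
    (hd : UpDegreeLE G r (s + 1) K i α) :
    UpDegreeLE G r s (K.erase k) i (recolorSet S k α) := by
  intro v hv hi
  have hvS : v ∉ S := by
    intro h
    simp [recolorSet, h] at hv
  have hvK : α v ∈ K := by
    simp only [recolorSet, hvS, if_false] at hv
    exact Finset.mem_of_mem_erase hv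
  obtain ⟨u, huv, hlt, hu⟩ : ∃ u, G.Adj v u ∧ r v < r u ∧ (u ∈ X ∨ u ∈ S) := by
    by_contra! hcon
    exact hvS ((hS v).2 ⟨⟨hvK, hi⟩, hcon⟩)
  have huk : recolorSet S k α u = k := by
    rw [hX] at hu
    unfold recolorSet
    grind
  have huK : α u ∈ K := by
    rcases hu with hu | hu
    · rw [(hX u).1 hu]
      exact hkK
    · exact ((hS u).1 hu).1.1
  have hss : upNeighbors G r (K.erase k) (recolorSet S k α) v ⊂ upNeighbors G r K α v := by
    refine ⟨fun x ⟨hx, hx', hx''⟩ => ⟨hx, hx', ?_⟩, fun h => ?_⟩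
    · have := (hS x).1
      unfold recolorSet at hx''
      grind
    · have := (h ⟨huv, hlt, huK⟩ : u ∈ upNeighbors G r (K.erase k) _ v).2.2
      simp [huk] at this
  have := Set.ncard_lt_ncard hss (Set.toFinite _)
  have := hd v hvK hi
  omega

end Kernel

/-- The property that palettes of size `s + 2` allow recoloring with `T` steps per vertex. -/
def Recolorable (G : SimpleGraph V) (q : ℕ) (r : V → ℕ) (s t T : ℕ) : Prop :=
  ∀ (K : Finset (Fin q)) (j : ℕ) (α β : V → Fin q), K.card = s + 2 → j ≤ t →
    ProperColoring G q α → ProperColoring G q β → UpDegreeLE G r s K j α →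
    AgreeOff r K j α β → Near G (T * Nat.card V) α β

theorem Recolorable.zero [Fintype V] {r : V → ℕ} (hr : ∀ u v, G.Adj u v → r u ≠ r v) (t : ℕ) :
    Recolorable G q r 0 t 1 := by
  intro K j α β _ _ hα hβ hd hab
  rw [one_mul, Nat.card_eq_fintype_card]
  have key : ∀ u v, G.Adj u v → r u < r v → α u ∈ K → r u < j → α v ∉ K := by
    intro u v huv hlt hu hj hv
    have := hd u hu hj
    rw [Nat.le_zero, Set.ncard_eq_zero (Set.toFinite _)] at this
    exact (this ▸ (⟨huv, hlt, hv⟩ : v ∈ upNeighbors G r K α u) : v ∈ (∅ : Set V))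
  refine near_of_independent hα hβ fun u v huv => ?_
  by_contra! hne
  have hu := (hab u).resolve_left hne.1
  have hv := (hab v).resolve_left hne.2
  rcases (hr u v huv).lt_or_gt with h | h
  · exact key u v huv h hu.1 hu.2.2 hv.1
  · exact key v u huv.symm h hv.1 hv.2.2 hu.1

/-- If color `k` is missing below rank `i`, it can be removed from rank `i` too. -/
theorem Recolorable.exists_remove_color_rank [Fintype V] {r : V → ℕ}
    (hr : ∀ u v, G.Adj u v → r u ≠ r v) {s t T : ℕ} (ih : Recolorable G q r s t T)
    {K : Finset (Fin q)} {k : Fin q} (hk : k ∈ K) (hK : K.card = s + 3) {i : ℕ} (hi : i < t)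
    {α : V → Fin q} (hα : ProperColoring G q α) (hd : UpDegreeLE G r (s + 1) K (i + 1) α)
    (hne : ∀ v, r v < i → α v ≠ k) :
    ∃ γ : V → Fin q, ProperColoring G q γ ∧ AgreeOff r K (i + 1) α γ ∧
      (∀ v, r v < i + 1 → γ v ≠ k) ∧ Near G ((T + 2) * Fintype.card V) α γ := by
  classical
  have hK' : (K.erase k).card = s + 2 := by
    rw [Finset.card_erase_of_mem hk, hK]
    rfl
  obtain ⟨γ, hγ, hγB, hγB'⟩ := exists_greedy_coloring hr (Finset.erase_subset k K) hα
    {v | α v ∈ K ∧ (r v < i ∨ (r v = i ∧ α v = k))}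
    (fun v hv => ⟨hv.1, by
      have := hd v hv.1 (by rcases hv.2 with h | h <;> omega)
      omega⟩)
    (fun u v _ hlt hu hv => ⟨hu, .inl (by rcases hv.2 with h | h <;> omega)⟩)
  simp only [Set.mem_ofPred_eq] at hγB hγB'
  simp only [Finset.mem_erase] at hγB'
  obtain ⟨S, hS⟩ := exists_kernel G r {v | α v ∈ K ∧ r v < i} {v | α v = k}
  have hS₁ : ProperColoring G q (recolorSet S k α) :=
    properColoring_recolorSet hr hα hne (fun _ => Iff.rfl) hS
  have hS₂ := near_recolorSet hα hS₁
  have hS₃ : UpDegreeLE G r s (K.erase k) i (recolorSet S k α) :=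
    upDegreeLE_recolorSet hk (fun _ => Iff.rfl) hS
      (fun v hv hvi => hd v hv (Nat.lt_succ_of_lt hvi))
  have hSsub : ∀ v ∈ S, α v ∈ K ∧ r v < i := fun v hv => ((hS v).1 hv).1
  let δ : V → Fin q := fun v =>
    if α v ∈ K ∧ r v < i ∧ v ∉ S then γ v else recolorSet S k α v
  have hδ : ProperColoring G q δ := by
    have key : ∀ u v, G.Adj u v → (α u ∈ K ∧ r u < i ∧ u ∉ S) →
        ¬(α v ∈ K ∧ r v < i ∧ v ∉ S) → γ u ≠ recolorSet S k α v := by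
      intro u v huv hu hv
      have h₁ := hγB' u ⟨hu.1, .inl hu.2.1⟩
      have h₂ := hSsub v
      have h₃ := hγB v
      have h₄ := hγ huv
      have h₅ := hk
      unfold recolorSet
      grind
    intro u v huv
    have h₁ := key u v huv
    have h₂ := key v u huv.symm
    have h₃ := hS₁ huv
    have h₄ := hγ huv
    simp only [δ]
    grind
  have hagree : AgreeOff r (K.erase k) i (recolorSet S k α) δ := by
    intro v
    have h₁ := hγB' v
    have h₂ := hne v
    simp only [δ]
    unfold recolorSet
    grind
  have hmid := ih _ i _ _ hK' hi.le hS₁ hδ hS₃ hagree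
  have hlast : Near G (Fintype.card V) δ γ := by
    refine near_of_differ_color hδ hγ k fun v hv => ?_
    have h₁ := hγB v
    have h₂ := hSsub v
    simp only [δ] at hv ⊢
    unfold recolorSet at *
    grind
  refine ⟨γ, hγ, fun v => ?_, fun v hv => ?_, ((hS₂.trans hmid).trans hlast).mono ?_⟩
  · have h₁ := hγB v
    have h₂ := hγB' v
    grind
  · have h₁ := hγB v
    have h₂ := hγB' v
    have h₃ := hne v
    grind
  · rw [Nat.card_eq_fintype_card]
    exact le_of_eq (by ring)

theorem Recolorable.exists_remove_color [Fintype V] {r : V → ℕ}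
    (hr : ∀ u v, G.Adj u v → r u ≠ r v) {s t T : ℕ} (ih : Recolorable G q r s t T)
    {K : Finset (Fin q)} {k : Fin q} (hk : k ∈ K) (hK : K.card = s + 3) {j : ℕ} (hj : j ≤ t)
    {α : V → Fin q} (hα : ProperColoring G q α) (hd : UpDegreeLE G r (s + 1) K j α) :
    ∃ γ : V → Fin q, ProperColoring G q γ ∧ AgreeOff r K j α γ ∧
      (∀ v, r v < j → γ v ≠ k) ∧ Near G (j * ((T + 2) * Fintype.card V)) α γ := by
  induction j with
  | zero => exact ⟨α, hα, fun v => .inl rfl, fun v hv => (Nat.not_lt_zero _ hv).elim,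
      Near.refl _ _⟩
  | succ j ihj =>
    obtain ⟨γ, hγ, hag, hne, hnear⟩ := ihj (Nat.le_of_succ_le hj)
      (fun v hv hvj => hd v hv (Nat.lt_succ_of_lt hvj))
    obtain ⟨γ', hγ', hag', hne', hnear'⟩ := ih.exists_remove_color_rank hr hk hK hj hγ
      (hd.of_mem_iff hag.mem_iff) hne
    exact ⟨γ', hγ', (hag.mono (Nat.le_succ j)).trans hag', hne',
      (hnear.trans hnear').mono (le_of_eq (by ring))⟩

theorem Recolorable.succ [Fintype V] {r : V → ℕ} (hr : ∀ u v, G.Adj u v → r u ≠ r v)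
    {s t T : ℕ} (ih : Recolorable G q r s t T) :
    Recolorable G q r (s + 1) t (2 * (t * (T + 2)) + 2 + T) := by
  intro K j α β hK hj hα hβ hd hab
  obtain ⟨k, hk⟩ : K.Nonempty := Finset.card_pos.mp (by omega)
  have hK' : (K.erase k).card = s + 2 := by
    rw [Finset.card_erase_of_mem hk, hK]
    rfl
  obtain ⟨α', hα', hag, hne, hnear⟩ := ih.exists_remove_color hr hk hK hj hα hd
  obtain ⟨β', hβ', hag', hne', hnear'⟩ := ih.exists_remove_color hr hk hK hj hβ
    (hd.of_mem_iff hab.mem_iff)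
  have hab' : AgreeOff r K j α' β' := (hag.symm.trans hab).trans hag'
  have hX : ∀ v, v ∈ {v | α' v = k} ↔ β' v = k := by
    intro v
    have h₁ := hab' v
    have h₂ := hne v
    have h₃ := hne' v
    simp only [Set.mem_ofPred_eq]
    grind
  obtain ⟨S, hS⟩ := exists_kernel G r {v | α' v ∈ K ∧ r v < j} {v | α' v = k}
  have hSβ : ∀ v, v ∈ S ↔ (β' v ∈ K ∧ r v < j) ∧
      ∀ u, G.Adj v u → r v < r u → u ∉ {v | α' v = k} ∧ u ∉ S := by
    intro v
    rw [hS v, Set.mem_ofPred_eq, hab'.mem_iff]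
  have hSα := properColoring_recolorSet hr hα' hne (fun _ => Iff.rfl) hS
  have hSβ' := properColoring_recolorSet hr hβ' hne' hX hSβ
  have hmid := ih (K.erase k) j _ _ hK' hj hSα hSβ'
    (upDegreeLE_recolorSet hk (fun _ => Iff.rfl) hS (hd.of_mem_iff hag.mem_iff)) (fun v => by
      have h₁ := hab' v
      have h₂ := hne v
      have h₃ := hne' v
      unfold recolorSet
      grind)
  refine ((((hnear.trans (near_recolorSet hα' hSα)).trans hmid).trans
    (near_recolorSet hβ' hSβ').symm).trans hnear'.symm).mono ?_
  rw [Nat.card_eq_fintype_card]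
  have := Nat.mul_le_mul_right ((T + 2) * Fintype.card V) hj
  calc _ = 2 * (j * ((T + 2) * Fintype.card V)) + (2 + T) * Fintype.card V := by ring
    _ ≤ 2 * (t * ((T + 2) * Fintype.card V)) + (2 + T) * Fintype.card V := by omega
    _ = _ := by ring

theorem Recolorable.mono {r : V → ℕ} {s t T T' : ℕ} (h : Recolorable G q r s t T)
    (hT : T ≤ T') : Recolorable G q r s t T' :=
  fun K j α β hK hj hα hβ hd hab =>
    (h K j α β hK hj hα hβ hd hab).mono (Nat.mul_le_mul_right _ hT)

theorem recolorable_pow [Fintype V] {r : V → ℕ} (hr : ∀ u v, G.Adj u v → r u ≠ r v) {t : ℕ}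
    (ht : 1 ≤ t) (s : ℕ) : Recolorable G q r s t ((9 * t) ^ s) := by
  induction s with
  | zero => simpa using Recolorable.zero hr t
  | succ s ih =>
    refine (ih.succ hr).mono ?_
    have hT : 1 ≤ (9 * t) ^ s := Nat.one_le_pow _ _ (by omega)
    rw [pow_succ]
    generalize (9 * t) ^ s = T at hT
    nlinarith [Nat.mul_le_mul ht hT, Nat.mul_le_mul_right T ht, Nat.mul_le_mul_left t hT]

end Recoloring

/-- For `s ≥ 0` there is a constant `C = C(s)` such that for every `t ≥ 1`
and every finite graph `G` with `n` vertices and degree depth `(s, t)`, the reconfiguration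
graph `R_{s+2}(G)` is connected with diameter at most `C * n * s * (2t)^s` (and at most
`C * n` when `s = 0`). -/
theorem statement4 (s : ℕ) :
    ∃ C : ℕ, ∀ (t : ℕ), 1 ≤ t →
      ∀ (V : Type) [Fintype V] [DecidableEq V] (G : SimpleGraph V)
        (P : Fin t → Set V), IsDegreePartition G s t P →
      ∀ α β : V → Fin (s + 2),
        ProperColoring G (s + 2) α → ProperColoring G (s + 2) β →
        ∃ m : ℕ,
          m ≤ (if s = 0 then C * Fintype.card V
               else C * Fintype.card V * s * (2 * t) ^ s) ∧
          ∃ c : ℕ → V → Fin (s + 2), c 0 = α ∧ c m = β ∧ RecoloringSeq G (s + 2) m c := by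
  refine ⟨5 ^ s, fun t ht V _ _ G P ⟨hP, hind, hdeg⟩ α β hα hβ => ?_⟩
  choose p hp hpu using hP
  have hr : ∀ u v, G.Adj u v → (p u : ℕ) ≠ p v := fun u v huv h =>
    hind (p u) u (hp u) v (Fin.ext h ▸ hp v) huv
  have hnear : Near G ((9 * t) ^ s * Nat.card V) α β := by
    refine recolorable_pow hr ht s Finset.univ t α β (by simp) le_rfl hα hβ (fun v _ _ => ?_)
      (fun v => .inr ⟨Finset.mem_univ _, Finset.mem_univ _, (p v).2⟩)
    refine le_trans (Set.ncard_le_ncard ?_ (Set.toFinite _)) (hdeg (p v) v (hp v))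
    exact fun u hu => ⟨hu.1, p u, Fin.le_def.2 hu.2.1.le, hp u⟩
  obtain ⟨m, hm, c, hc⟩ := hnear.exists_recoloringSeq hα
  refine ⟨m, hm.trans ?_, c, hc⟩
  rw [Nat.card_eq_fintype_card]
  split_ifs with hs
  · simp [hs]
  · calc (9 * t) ^ s * Fintype.card V ≤ (5 * (2 * t)) ^ s * Fintype.card V :=
          Nat.mul_le_mul_right _ (Nat.pow_le_pow_left (by omega) s)
      _ = 5 ^ s * Fintype.card V * 1 * (2 * t) ^ s := by
          rw [mul_pow]
          ring
      _ ≤ 5 ^ s * Fintype.card V * s * (2 * t) ^ s :=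
          Nat.mul_le_mul_right _ (Nat.mul_le_mul_left _ (Nat.one_le_iff_ne_zero.2 hs))
end

section
/- Let k, n ≥ 1 be integers. There is a constant C (independent of k and n) such that for every k-degenerate finite simple graph G with n vertices, the reconfiguration graph R_{k+2}(G) of (k+2)-colorings of G is connected and has diameter at most C · 2^{k} · n^{k+1}. -/
/-- `G` is `k`-degenerate: every nonempty (induced) subgraph has a vertex of degree at
most `k` within it. -/
def Degenerate {V : Type} (G : SimpleGraph V) (k : ℕ) : Prop :=
  ∀ A : Set V, A.Nonempty → ∃ v ∈ A, {u : V | u ∈ A ∧ G.Adj v u}.ncard ≤ k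

/-- `a` and `b` are joined by a chain of at most `m` steps of the relation `R`. -/
inductive ReachIn {X : Type*} (R : X → X → Prop) : ℕ → X → X → Prop
  | refl (m : ℕ) (a : X) : ReachIn R m a a
  | tail {m : ℕ} {a b c : X} : ReachIn R m a b → R b c → ReachIn R (m + 1) a c

namespace ReachIn

variable {X : Type*} {R : X → X → Prop}

theorem mono {m n : ℕ} {a b : X} (h : ReachIn R m a b) (hmn : m ≤ n) : ReachIn R n a b := by
  induction h generalizing n with
  | refl m a => exact .refl n a
  | tail _ hs ih =>
    obtain ⟨n, rfl⟩ : ∃ p, n = p + 1 := ⟨n - 1, by omega⟩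
    exact .tail (ih (by omega)) hs

theorem trans {m n : ℕ} {a b c : X} (h : ReachIn R m a b) (h' : ReachIn R n b c) :
    ReachIn R (m + n) a c := by
  induction h' with
  | refl n b => exact h.mono (by omega)
  | tail _ hs ih => exact .tail (ih h) hs

theorem single {a b : X} (h : R a b) : ReachIn R 1 a b := .tail (.refl 0 a) h

theorem symm (hR : ∀ a b, R a b → R b a) {m : ℕ} {a b : X} (h : ReachIn R m a b) :
    ReachIn R m b a := by
  induction h with
  | refl m a => exact .refl m a
  | tail _ hs ih => exact ((single (hR _ _ hs)).trans ih).mono (by omega)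

end ReachIn

section ListRecoloring

variable {V κ : Type*}

/-- `f` restricted to `A` is a proper list coloring of `G[A]` for the lists `L`. -/
def IsListColoring (G : SimpleGraph V) (A : Finset V) (L : V → Finset κ) (f : V → κ) : Prop :=
  ∀ v ∈ A, f v ∈ L v ∧ ∀ u ∈ A, G.Adj v u → f v ≠ f u

/-- One recoloring step (possibly trivial) between list colorings, at a vertex of `A`. -/
def RecolorStep (G : SimpleGraph V) (A : Finset V) (L : V → Finset κ) (f g : V → κ) : Prop :=
  IsListColoring G A L f ∧ IsListColoring G A L g ∧ ∃ v ∈ A, ∀ u, u ≠ v → f u = g u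

/-- The out-neighbors of `v` in `A`, for the orientation in which `r` increases. -/
def outNbrs (G : SimpleGraph V) [DecidableRel G.Adj] (r : V → ℕ) (A : Finset V) (v : V) :
    Finset V :=
  A.filter fun u => G.Adj v u ∧ r v < r u

/-- All lists on `A` are contained in `T` and exceed the out-degree by at least `s`. -/
def Feasible (G : SimpleGraph V) [DecidableRel G.Adj] (r : V → ℕ) (A : Finset V)
    (L : V → Finset κ) (T : Finset κ) (s : ℕ) : Prop :=
  ∀ v ∈ A, L v ⊆ T ∧ (outNbrs G r A v).card + s ≤ (L v).card

/-- The color `c` is full: every vertex of `A` that has `c` in its list has color `c` or an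
out-neighbor of color `c`. -/
def IsFull (G : SimpleGraph V) [DecidableRel G.Adj] (r : V → ℕ) (A : Finset V)
    (L : V → Finset κ) (c : κ) (f : V → κ) : Prop :=
  ∀ v ∈ A, c ∈ L v → f v ≠ c → ∃ u ∈ outNbrs G r A v, f u = c

variable {G : SimpleGraph V} {r : V → ℕ} {A : Finset V} {L : V → Finset κ} {T : Finset κ}
  {f g : V → κ}

theorem mem_outNbrs [DecidableRel G.Adj] {u v : V} :
    u ∈ outNbrs G r A v ↔ u ∈ A ∧ G.Adj v u ∧ r v < r u := by
  simp [outNbrs]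

theorem ReachIn.recolor_symm {m : ℕ} (h : ReachIn (RecolorStep G A L) m f g) :
    ReachIn (RecolorStep G A L) m g f :=
  h.symm fun _ _ ⟨h₁, h₂, v, hv, h₃⟩ => ⟨h₂, h₁, v, hv, fun u hu => (h₃ u hu).symm⟩

theorem ReachIn.eq_off {m : ℕ} (h : ReachIn (RecolorStep G A L) m f g) {u : V} (hu : u ∉ A) :
    g u = f u := by
  induction h with
  | refl => rfl
  | tail _ hs ih =>
    obtain ⟨-, -, v, hv, hs⟩ := hs
    rw [← ih, hs u (by rintro rfl; exact hu hv)]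

theorem ReachIn.isListColoring {m : ℕ} (h : ReachIn (RecolorStep G A L) m f g)
    (hf : IsListColoring G A L f) : IsListColoring G A L g := by
  cases h with
  | refl => exact hf
  | tail _ hs => exact hs.2.1

theorem ReachIn.lift {A' : Finset V} {L' : V → Finset κ} {m : ℕ} (hA : A' ⊆ A)
    (hlift : ∀ h, IsListColoring G A' L' h → (∀ u, u ∉ A' → h u = f u) → IsListColoring G A L h)
    (h : ReachIn (RecolorStep G A' L') m f g) : ReachIn (RecolorStep G A L) m f g := by
  induction h with
  | refl m f => exact .refl m f
  | tail hr hs ih =>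
    refine .tail (ih hlift) ⟨hlift _ hs.1 fun u hu => hr.eq_off hu,
      hlift _ hs.2.1 fun u hu => (hr.tail hs).eq_off hu, ?_⟩
    obtain ⟨-, -, v, hv, hs⟩ := hs
    exact ⟨v, hA hv, hs⟩

theorem IsListColoring.of_filter_erase [DecidableEq κ] {c : κ} {h : V → κ}
    (hf : IsListColoring G A L f)
    (hh : IsListColoring G (A.filter (f · ≠ c)) (fun v => (L v).erase c) h)
    (hoff : ∀ u, u ∉ A.filter (f · ≠ c) → h u = f u) : IsListColoring G A L h := by
  have hc : ∀ v ∈ A, f v = c → h v = c := fun v _ hvc => by rw [hoff v (by simp [hvc]), hvc]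
  have hm : ∀ v ∈ A, f v ≠ c → v ∈ A.filter (f · ≠ c) := fun v hv hvc => by simp [hv, hvc]
  intro v hv
  by_cases hvc : f v = c
  · refine ⟨by rw [hc v hv hvc, ← hvc]; exact (hf v hv).1, fun u hu huv => ?_⟩
    by_cases huc : f u = c
    · exact absurd (hvc.trans huc.symm) ((hf v hv).2 u hu huv)
    · rw [hc v hv hvc]
      exact (Finset.ne_of_mem_erase (hh u (hm u hu huc)).1).symm
  · refine ⟨Finset.mem_of_mem_erase (hh v (hm v hv hvc)).1, fun u hu huv => ?_⟩
    by_cases huc : f u = c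
    · rw [hc u hu huc]
      exact Finset.ne_of_mem_erase (hh v (hm v hv hvc)).1
    · exact (hh v (hm v hv hvc)).2 u (hm u hu huc) huv

/-- If every mixture of `f` and `g` is a list coloring, recolor the vertices one by one. -/
theorem reachIn_of_piecewise [DecidableEq V] (hoff : ∀ u, u ∉ A → g u = f u)
    (hmix : ∀ S ⊆ A, IsListColoring G A L (S.piecewise g f)) :
    ReachIn (RecolorStep G A L) A.card f g := by
  have key : ∀ S ⊆ A, ReachIn (RecolorStep G A L) S.card f (S.piecewise g f) := by
    intro S
    induction S using Finset.induction_on with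
    | empty => intro _; simpa using ReachIn.refl 0 f
    | insert v S hv ih =>
      intro hS
      rw [Finset.card_insert_of_notMem hv]
      have hS' : S ⊆ A := fun x hx => hS (Finset.mem_insert_of_mem hx)
      refine .tail (ih hS') ⟨hmix _ hS', hmix _ hS, v, hS (Finset.mem_insert_self v S), ?_⟩
      intro u hu
      simp [Finset.piecewise, hu]
  have hg : A.piecewise g f = g := by
    ext u
    by_cases hu : u ∈ A <;> simp [hu, hoff]
  simpa [hg] using key A subset_rfl

variable [DecidableRel G.Adj]

/-- The class of a full color depends only on the lists. -/
theorem IsFull.eq_iff_eq {c : κ} (hf : IsListColoring G A L f)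
    (hg : IsListColoring G A L g) (hfc : IsFull G r A L c f) (hgc : IsFull G r A L c g) {v : V}
    (hv : v ∈ A) : f v = c ↔ g v = c := by
  have key : ∀ f, IsListColoring G A L f → IsFull G r A L c f → ∀ v ∈ A,
      (f v = c ↔ c ∈ L v ∧ ∀ u ∈ outNbrs G r A v, f u ≠ c) := by
    intro f hf hfc v hv
    constructor
    · rintro rfl
      exact ⟨(hf v hv).1, fun u hu =>
        ((hf v hv).2 u (mem_outNbrs.1 hu).1 (mem_outNbrs.1 hu).2.1).symm⟩
    · rintro ⟨h₁, h₂⟩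
      by_contra h
      obtain ⟨u, hu, hu'⟩ := hfc v hv h₁ h
      exact h₂ u hu hu'
  obtain ⟨N, hN⟩ : ∃ N, ∀ v ∈ A, r v < N :=
    ⟨A.sup r + 1, fun v hv => Nat.lt_succ_of_le (Finset.le_sup hv)⟩
  induction hm : N - r v using Nat.strong_induction_on generalizing v with
  | _ m ih =>
    rw [key f hf hfc v hv, key g hg hgc v hv]
    refine and_congr_right fun _ => forall₂_congr fun u hu => not_congr ?_
    have := mem_outNbrs.1 hu
    have := hN u this.1
    exact ih _ (by omega) (mem_outNbrs.1 hu).1 rfl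

/-- Deleting a full color class and its color keeps the lists feasible. -/
theorem IsFull.feasible [DecidableEq κ] {c : κ} {s : ℕ} (hc : IsFull G r A L c f)
    (hL : Feasible G r A L T s) :
    Feasible G r (A.filter (f · ≠ c)) (fun v => (L v).erase c) (T.erase c) s := by
  intro v hv
  obtain ⟨hv, hvc⟩ := Finset.mem_filter.1 hv
  refine ⟨Finset.erase_subset_erase _ (hL v hv).1, ?_⟩
  have hsub : outNbrs G r (A.filter (f · ≠ c)) v ⊆ outNbrs G r A v := by
    intro u
    simp only [mem_outNbrs, Finset.mem_filter]
    tauto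
  have h₂ := (hL v hv).2
  by_cases hcv : c ∈ L v
  · obtain ⟨u, hu, huc⟩ := hc v hv hcv hvc
    have hss : outNbrs G r (A.filter (f · ≠ c)) v ⊂ outNbrs G r A v :=
      Finset.ssubset_iff_of_subset hsub |>.2 ⟨u, hu, by simp [mem_outNbrs, huc]⟩
    have := Finset.card_lt_card hss
    simp only [Finset.card_erase_of_mem hcv]
    omega
  · simp only [Finset.erase_eq_of_notMem hcv]
    have := Finset.card_le_card hsub
    omega

/-- Any two list colorings for feasible lists with `t` colors in total are joined by at most
`B |A|` recoloring steps. -/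
def RecolorBound (G : SimpleGraph V) [DecidableRel G.Adj] (r : V → ℕ) (κ : Type*)
    (t : ℕ) (B : ℕ → ℕ) : Prop :=
  ∀ (A : Finset V) (L : V → Finset κ) (T : Finset κ), T.card = t → Feasible G r A L T 2 →
    ∀ f g, IsListColoring G A L f → IsListColoring G A L g → (∀ u, u ∉ A → g u = f u) →
      ReachIn (RecolorStep G A L) (B A.card) f g

variable {t : ℕ} {B : ℕ → ℕ}

/-- Recoloring outside the class of a full color. -/
theorem RecolorBound.reachIn_of_isFull [DecidableEq κ] (hB : RecolorBound G r κ t B)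
    (hBm : Monotone B) {c : κ} (hT : T.card = t + 1) (hcT : c ∈ T) (hL : Feasible G r A L T 2)
    (hf : IsListColoring G A L f) (hc : IsFull G r A L c f)
    (hg : IsListColoring G (A.filter (f · ≠ c)) (fun v => (L v).erase c) g)
    (hoff : ∀ u, u ∉ A.filter (f · ≠ c) → g u = f u) :
    ReachIn (RecolorStep G A L) (B A.card) f g := by
  refine .lift (Finset.filter_subset _ _) (fun h hh hoff => hf.of_filter_erase hh hoff)
    ((hB _ _ (T.erase c) (by simp [hcT, hT]) (hc.feasible hL) f g ?_ hg hoff).mono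
      (hBm (Finset.card_filter_le _ _)))
  intro v hv
  obtain ⟨hv, hvc⟩ := Finset.mem_filter.1 hv
  exact ⟨Finset.mem_erase.2 ⟨hvc, (hf v hv).1⟩,
    fun u hu huv => (hf v hv).2 u (Finset.mem_filter.1 hu).1 huv⟩

variable [DecidableEq V]

theorem exists_isListColoring [DecidableEq κ] (hr : r.Injective) (hL : Feasible G r A L T 1)
    (f : V → κ) :
    ∃ g, IsListColoring G A L g ∧ ∀ u, u ∉ A → g u = f u := by
  induction A using Finset.induction_on_min_value r with
  | empty => exact ⟨f, by simp [IsListColoring], fun _ _ => rfl⟩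
  | insert v A hv hmin ih =>
    obtain ⟨g, hg, hgf⟩ := ih fun u hu => by
      refine ⟨(hL u (Finset.mem_insert_of_mem hu)).1, le_trans ?_
        (hL u (Finset.mem_insert_of_mem hu)).2⟩
      gcongr
      intro w
      simp only [mem_outNbrs, Finset.mem_insert]
      tauto
    have hcard : (((outNbrs G r (insert v A) v).image g)).card < (L v).card :=
      lt_of_le_of_lt Finset.card_image_le (hL v (Finset.mem_insert_self v A)).2
    obtain ⟨x, hx, hx'⟩ := Finset.exists_mem_notMem_of_card_lt_card hcard
    have hne : ∀ u ∈ A, G.Adj v u → x ≠ g u := by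
      rintro u hu huv rfl
      refine hx' (Finset.mem_image_of_mem g (mem_outNbrs.2 ⟨Finset.mem_insert_of_mem hu, huv, ?_⟩))
      exact lt_of_le_of_ne (hmin u hu) (hr.ne huv.ne)
    have hA : ∀ u ∈ A, u ≠ v := by
      rintro u hu rfl
      exact hv hu
    refine ⟨Function.update g v x, ?_, ?_⟩
    · intro u hu
      rcases Finset.mem_insert.1 hu with rfl | huA
      · refine ⟨by simpa using hx, fun w hw huw => ?_⟩
        rcases Finset.mem_insert.1 hw with rfl | hw
        · exact absurd huw (G.irrefl)
        · simpa [hA w hw] using hne w hw huw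
      · refine ⟨by simpa [hA u huA] using (hg u huA).1, fun w hw huw => ?_⟩
        rcases Finset.mem_insert.1 hw with rfl | hw
        · simpa [hA u huA] using (hne u huA huw.symm).symm
        · simpa [hA u huA, hA w hw] using (hg u huA).2 w hw huw
    · intro u hu
      simp only [Finset.mem_insert, not_or] at hu
      simp [hu.1, hgf u hu.2]

/-- Greedy choice of a color class that makes `c` full. -/
theorem exists_kernel_s5 (r : V → ℕ) (A : Finset V) (L : V → Finset κ) (c : κ) :
    ∃ K : Finset V, ∀ v ∈ A, v ∈ K ↔ c ∈ L v ∧ ∀ u ∈ outNbrs G r A v, u ∉ K := by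
  induction A using Finset.induction_on_min_value r with
  | empty => exact ⟨∅, by simp⟩
  | insert v A hv hmin ih =>
    obtain ⟨K, hK⟩ := ih
    have hout : ∀ u, r v ≤ r u → outNbrs G r (insert v A) u = outNbrs G r A u := by
      intro u hu
      ext w
      simp only [mem_outNbrs, Finset.mem_insert]
      constructor
      · rintro ⟨rfl | hw, h₁, h₂⟩
        · omega
        · exact ⟨hw, h₁, h₂⟩
      · tauto
    have hvout : ∀ u, v ∉ outNbrs G r A u := fun u h => hv (mem_outNbrs.1 h).1
    by_cases h : c ∈ L v ∧ ∀ u ∈ outNbrs G r A v, u ∉ K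
    · refine ⟨insert v K, fun u hu => ?_⟩
      rcases Finset.mem_insert.1 hu with rfl | hu
      · rw [hout _ le_rfl]
        simp only [Finset.mem_insert, true_or, true_iff, not_or]
        exact ⟨h.1, fun w hw => ⟨fun e => hvout _ (e ▸ hw), h.2 w hw⟩⟩
      · rw [hout _ (hmin u hu)]
        have huv : u ≠ v := fun e => hv (e ▸ hu)
        simp only [Finset.mem_insert, huv, false_or, hK u hu, not_or]
        exact and_congr_right fun _ => forall₂_congr fun w hw =>
          ⟨fun h' => ⟨fun e => hvout _ (e ▸ hw), h'⟩, fun h' => h'.2⟩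
    · refine ⟨K.erase v, fun u hu => ?_⟩
      rcases Finset.mem_insert.1 hu with rfl | hu
      · rw [hout _ le_rfl]
        simp only [Finset.mem_erase, ne_eq, not_true_eq_false, false_and, false_iff]
        exact fun h' => h ⟨h'.1, fun w hw hwK =>
          h'.2 w hw ⟨fun e => hvout _ (e ▸ hw), hwK⟩⟩
      · rw [hout _ (hmin u hu)]
        have huv : u ≠ v := fun e => hv (e ▸ hu)
        simp only [Finset.mem_erase, ne_eq, huv, not_false_eq_true, true_and, hK u hu]
        exact and_congr_right fun _ => forall₂_congr fun w hw =>
          ⟨fun h' h'' => h' h''.2, fun h' h'' => h' ⟨fun e => hvout _ (e ▸ hw), h''⟩⟩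

/-- If `c` is used only on sinks of `A`, then `c` can be made full in at most `|A|` steps. -/
theorem exists_reachIn_isFull (hr : r.Injective) {c : κ} (hf : IsListColoring G A L f)
    (hc : ∀ v ∈ A, f v = c → outNbrs G r A v = ∅) :
    ∃ g, ReachIn (RecolorStep G A L) A.card f g ∧ IsFull G r A L c g := by
  obtain ⟨K, hK⟩ := exists_kernel_s5 (G := G) r A L c
  have hcK : ∀ v ∈ A, f v = c → v ∈ K := fun v hv h =>
    (hK v hv).2 ⟨h ▸ (hf v hv).1, by simp [hc v hv h]⟩
  have hind : ∀ v ∈ A, ∀ u ∈ A, G.Adj v u → v ∈ K → u ∉ K := by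
    intro v hv u hu huv hvK huK
    rcases lt_or_gt_of_ne (hr.ne huv.ne) with h | h
    · exact ((hK v hv).1 hvK).2 u (mem_outNbrs.2 ⟨hu, huv, h⟩) huK
    · exact ((hK u hu).1 huK).2 v (mem_outNbrs.2 ⟨hv, huv.symm, h⟩) hvK
  refine ⟨(A ∩ K).piecewise (fun _ => c) f, reachIn_of_piecewise ?_ ?_, ?_⟩
  · intro u hu
    simp [hu]
  · intro S hS v hv
    have hmix : ∀ w ∈ A, (w ∈ K ∧ S.piecewise ((A ∩ K).piecewise (fun _ => c) f) f w = c) ∨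
        (S.piecewise ((A ∩ K).piecewise (fun _ => c) f) f w = f w ∧ f w ≠ c) := by
      intro w hw
      have := hcK w hw
      by_cases h₁ : w ∈ S <;> by_cases h₂ : w ∈ K <;> by_cases h₃ : f w = c <;>
        simp_all
    refine ⟨?_, fun u hu huv => ?_⟩
    · rcases hmix v hv with h | h
      · rw [h.2]
        exact ((hK v hv).1 h.1).1
      · rw [h.1]
        exact (hf v hv).1
    · have h₁ := hind v hv u hu huv
      have h₂ := (hf v hv).2 u hu huv
      rcases hmix v hv with h | h <;> rcases hmix u hu with h' | h'
      · exact absurd h'.1 (h₁ h.1)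
      · rw [h.2, h'.1]
        exact h'.2.symm
      · rw [h.1, h'.2]
        exact h.2
      · rwa [h.1, h'.1]
  · intro v hv hcv hne
    have hvK : v ∉ K := fun h => hne (by simp [hv, h])
    rw [hK v hv] at hvK
    push Not at hvK
    obtain ⟨u, hu, huK⟩ := hvK hcv
    exact ⟨u, hu, by simp [(mem_outNbrs.1 hu).1, huK]⟩

theorem recolorBound_two (hr : r.Injective) : RecolorBound G r κ 2 id := by
  intro A L T hT hL f g hf hg hoff
  have hempty : ∀ v ∈ A, outNbrs G r A v = ∅ := by
    intro v hv
    have h₁ := Finset.card_le_card (hL v hv).1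
    have h₂ := (hL v hv).2
    exact Finset.card_eq_zero.1 (by omega)
  have hadj : ∀ v ∈ A, ∀ u ∈ A, ¬ G.Adj v u := by
    intro v hv u hu huv
    rcases lt_or_gt_of_ne (hr.ne huv.ne) with h | h
    · simpa [hempty v hv] using mem_outNbrs.2 ⟨hu, huv, h⟩
    · simpa [hempty u hu] using mem_outNbrs.2 ⟨hv, huv.symm, h⟩
  refine reachIn_of_piecewise hoff fun S hS v hv =>
    ⟨?_, fun u hu huv => absurd huv (hadj v hv u hu)⟩
  by_cases h : v ∈ S
  · simpa [h] using (hg v hv).1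
  · simpa [h] using (hf v hv).1

variable [DecidableEq κ]

/-- When `c` is full, another color `b` can be eliminated. -/
theorem RecolorBound.exists_avoid (hr : r.Injective) (hB : RecolorBound G r κ t B)
    (hBm : Monotone B) {b c : κ} (hbc : b ≠ c) (hT : T.card = t + 1) (hcT : c ∈ T)
    (hL : Feasible G r A L T 2) (hf : IsListColoring G A L f) (hc : IsFull G r A L c f) :
    ∃ g, ReachIn (RecolorStep G A L) (B A.card) f g ∧ ∀ v ∈ A, g v ≠ b := by
  have hL' : Feasible G r (A.filter (f · ≠ c)) (fun v => ((L v).erase c).erase b) T 1 := by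
    intro v hv
    obtain ⟨h₁, h₂⟩ := hc.feasible hL v hv
    refine ⟨((Finset.erase_subset _ _).trans h₁).trans (Finset.erase_subset _ _), ?_⟩
    have := Finset.pred_card_le_card_erase (s := (L v).erase c) (a := b)
    simp only at h₂ ⊢
    omega
  obtain ⟨g, hg, hoff⟩ := exists_isListColoring hr hL' f
  refine ⟨g, hB.reachIn_of_isFull hBm hT hcT hL hf hc
    (fun v hv => ⟨Finset.mem_of_mem_erase (hg v hv).1, (hg v hv).2⟩) hoff, fun v hv => ?_⟩
  by_cases hvc : f v = c
  · rw [hoff v (by simp [hvc]), hvc]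
    exact hbc.symm
  · exact Finset.ne_of_mem_erase (hg v (by simp [hv, hvc])).1

/-- Any list coloring can be recolored to one in which `c` is full. -/
theorem RecolorBound.exists_isFull (hr : r.Injective) (hB : RecolorBound G r κ t B)
    (hBm : Monotone B) (ht : 1 ≤ t) {c : κ} (hT : T.card = t + 1) (hcT : c ∈ T)
    (hL : Feasible G r A L T 2) (hf : IsListColoring G A L f) :
    ∃ g, ReachIn (RecolorStep G A L) (∑ j ∈ Finset.range A.card, (2 * B j + 2 * j + 1)) f g ∧
      IsFull G r A L c g := by
  induction A using Finset.induction_on_max_value r generalizing L with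
  | empty => exact ⟨f, .refl _ _, by simp [IsFull]⟩
  | insert v A hv hmax ih =>
    obtain ⟨b, hbT, hbc⟩ := Finset.exists_mem_ne (s := T) (by omega) c
    have hlt : ∀ u ∈ A, r u < r v := fun u hu =>
      lt_of_le_of_ne (hmax u hu) (hr.ne fun e => hv (e ▸ hu))
    have hvA : ∀ u ∈ A, u ≠ v := fun u hu e => hv (e ▸ hu)
    set L' : V → Finset κ := fun u => if G.Adj u v then (L u).erase (f v) else L u with hL'def
    have hLL : ∀ u, L' u ⊆ L u := by
      intro u
      simp only [hL'def]
      split_ifs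
      · exact Finset.erase_subset _ _
      · exact subset_rfl
    have hL' : Feasible G r A L' T 2 := by
      intro u hu
      obtain ⟨h₁, h₂⟩ := hL u (Finset.mem_insert_of_mem hu)
      refine ⟨(hLL u).trans h₁, ?_⟩
      by_cases huv : G.Adj u v
      · have hout : outNbrs G r (insert v A) u = insert v (outNbrs G r A u) := by
          ext w
          simp only [mem_outNbrs, Finset.mem_insert]
          constructor
          · tauto
          · rintro (rfl | h)
            · exact ⟨.inl rfl, huv, hlt u hu⟩
            · tauto
        rw [hout, Finset.card_insert_of_notMem fun h => hv (mem_outNbrs.1 h).1] at h₂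
        have := Finset.pred_card_le_card_erase (s := L u) (a := f v)
        simp only [hL'def, huv, if_true]
        omega
      · have hsub : outNbrs G r A u ⊆ outNbrs G r (insert v A) u := by
          intro w
          simp only [mem_outNbrs, Finset.mem_insert]
          tauto
        have := Finset.card_le_card hsub
        simp only [hL'def, huv, if_false]
        omega
    have hf' : IsListColoring G A L' f := by
      intro u hu
      obtain ⟨h₁, h₂⟩ := hf u (Finset.mem_insert_of_mem hu)
      refine ⟨?_, fun w hw => h₂ w (Finset.mem_insert_of_mem hw)⟩
      by_cases huv : G.Adj u v
      · simp only [hL'def, huv, if_true]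
        exact Finset.mem_erase.2 ⟨h₂ v (Finset.mem_insert_self v A) huv, h₁⟩
      · simpa only [hL'def, huv, if_false] using h₁
    have hlift : ∀ h, IsListColoring G A L' h → (∀ u, u ∉ A → h u = f u) →
        IsListColoring G (insert v A) L h := by
      intro h hh hoff
      have hadj : ∀ u ∈ A, G.Adj u v → h u ≠ h v := by
        intro u hu huv
        have := (hh u hu).1
        simp only [hL'def, huv, if_true] at this
        rw [hoff v hv]
        exact Finset.ne_of_mem_erase this
      intro u hu
      rcases Finset.mem_insert.1 hu with rfl | huA
      · refine ⟨by rw [hoff u hv]; exact (hf u (Finset.mem_insert_self u A)).1,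
          fun w hw huw => ?_⟩
        rcases Finset.mem_insert.1 hw with rfl | hw
        · exact absurd huw G.irrefl
        · exact (hadj w hw huw.symm).symm
      · refine ⟨hLL u (hh u huA).1, fun w hw huw => ?_⟩
        rcases Finset.mem_insert.1 hw with rfl | hw
        · exact hadj u huA huw
        · exact (hh u huA).2 w hw huw
    obtain ⟨f₁, h₁, hfull₁⟩ := ih hL' hf'
    have hf₁ := h₁.isListColoring hf'
    obtain ⟨f₂, h₂, havoid₂⟩ := hB.exists_avoid hr hBm hbc hT hcT hL' hf₁ hfull₁
    have hf₂ := h₂.isListColoring hf₁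
    obtain ⟨f₃, h₃, hfull₃⟩ :=
      exists_reachIn_isFull hr hf₂ fun u hu hub => absurd hub (havoid₂ u hu)
    have hf₃ := h₃.isListColoring hf₂
    obtain ⟨f₄, h₄, havoid₄⟩ := hB.exists_avoid hr hBm hbc.symm hT hbT hL' hf₃ hfull₃
    have hr₄ := ((h₁.trans h₂).trans h₃).trans h₄
    have hf₄ := hlift f₄ (h₄.isListColoring hf₃) fun u hu => hr₄.eq_off hu
    obtain ⟨f₅, h₅, hfull₅⟩ := exists_reachIn_isFull (r := r) (c := c) hr hf₄ (by
      intro u hu huc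
      rcases Finset.mem_insert.1 hu with rfl | hu
      · refine Finset.eq_empty_of_forall_notMem fun w hw => ?_
        obtain ⟨hw, -, hlt'⟩ := mem_outNbrs.1 hw
        rcases Finset.mem_insert.1 hw with rfl | hw
        · omega
        · exact absurd (hlt w hw) (by omega)
      · exact absurd huc (havoid₄ u hu))
    refine ⟨f₅, ((hr₄.lift (Finset.subset_insert v A) hlift).trans h₅).mono ?_, hfull₅⟩
    rw [Finset.card_insert_of_notMem hv, Finset.sum_range_succ]
    omega

theorem RecolorBound.succ (hr : r.Injective) (hB : RecolorBound G r κ t B) (hBm : Monotone B)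
    (ht : 1 ≤ t) : RecolorBound G r κ (t + 1)
      fun n => 2 * ∑ j ∈ Finset.range n, (2 * B j + 2 * j + 1) + B n := by
  intro A L T hT hL f g hf hg hoff
  obtain ⟨c, hcT⟩ := Finset.card_pos.1 (by omega : 0 < T.card)
  obtain ⟨f', hf', hfc⟩ := hB.exists_isFull hr hBm ht hT hcT hL hf
  obtain ⟨g', hg', hgc⟩ := hB.exists_isFull hr hBm ht hT hcT hL hg
  have hfl := hf'.isListColoring hf
  have hgl := hg'.isListColoring hg
  have hiff : ∀ v ∈ A, (f' v = c ↔ g' v = c) := fun v hv =>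
    IsFull.eq_iff_eq hfl hgl hfc hgc hv
  have hmid : ReachIn (RecolorStep G A L) (B A.card) f' g' := by
    refine hB.reachIn_of_isFull hBm hT hcT hL hfl hfc (fun v hv => ?_) fun u hu => ?_
    · obtain ⟨hv, hvc⟩ := Finset.mem_filter.1 hv
      exact ⟨Finset.mem_erase.2 ⟨fun h => hvc ((hiff v hv).2 h), (hgl v hv).1⟩,
        fun u hu => (hgl v hv).2 u (Finset.mem_filter.1 hu).1⟩
    · by_cases huA : u ∈ A
      · have huc : f' u = c := by simpa [huA] using hu
        rw [huc, (hiff u huA).1 huc]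
      · rw [hf'.eq_off huA, hg'.eq_off huA, hoff u huA]
  exact ((hf'.trans hmid).trans hg'.recolor_symm).mono (by dsimp only; omega)

end ListRecoloring

/-- The number of steps that suffices for `t + 2` colors and `n` vertices. -/
def recolorLength : ℕ → ℕ → ℕ
  | 0, n => n
  | t + 1, n => 2 * ∑ j ∈ Finset.range n, (2 * recolorLength t j + 2 * j + 1) + recolorLength t n

theorem monotone_recolorLength (t : ℕ) : Monotone (recolorLength t) := by
  induction t with
  | zero => exact fun _ _ h => h
  | succ t ih =>
    intro m n h
    have := ih h
    simp only [recolorLength]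
    gcongr

theorem recolorBound_recolorLength {V κ : Type*} [DecidableEq V] [DecidableEq κ]
    {G : SimpleGraph V} [DecidableRel G.Adj] {r : V → ℕ} (hr : r.Injective) (t : ℕ) :
    RecolorBound G r κ (t + 2) (recolorLength t) := by
  induction t with
  | zero => exact recolorBound_two hr
  | succ t ih => exact ih.succ hr (monotone_recolorLength t) (by omega)

theorem succ_mul_sum_range_pow_le (p n : ℕ) :
    (p + 1) * ∑ j ∈ Finset.range n, j ^ p ≤ n ^ (p + 1) := by
  induction n with
  | zero => simp
  | succ n ih =>
    rw [Finset.sum_range_succ, mul_add]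
    have key : n ^ (p + 1) + (p + 1) * n ^ p ≤ (n + 1) ^ (p + 1) := by
      clear ih
      induction p with
      | zero => simp
      | succ p ih =>
        calc n ^ (p + 1 + 1) + (p + 1 + 1) * n ^ (p + 1)
            ≤ (n ^ (p + 1) + (p + 1) * n ^ p) * (n + 1) := by
              have := Nat.zero_le ((p + 1) * n ^ p)
              ring_nf at this ⊢
              nlinarith
          _ ≤ (n + 1) ^ (p + 1) * (n + 1) := by gcongr
          _ = (n + 1) ^ (p + 1 + 1) := (pow_succ _ _).symm
    omega

theorem recolorLength_succ_le {t D : ℕ} (h : ∀ n, recolorLength t n ≤ D * n ^ (t + 1)) (n : ℕ) :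
    (t + 2) * recolorLength (t + 1) n ≤ (4 * D + (t + 2) * D + (t + 2) * 2) * n ^ (t + 2) := by
  have h₁ : ∑ j ∈ Finset.range n, (2 * recolorLength t j + 2 * j + 1) ≤
      2 * D * ∑ j ∈ Finset.range n, j ^ (t + 1) + n ^ 2 := by
    induction n with
    | zero => simp
    | succ n ih =>
      rw [Finset.sum_range_succ, Finset.sum_range_succ]
      have := h n
      nlinarith
  have h₂ := succ_mul_sum_range_pow_le (t + 1) n
  have h₃ : n ^ 2 ≤ n ^ (t + 2) := by
    rcases n.eq_zero_or_pos with rfl | hn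
    · simp
    · exact Nat.pow_le_pow_right hn (by omega)
  have h₄ : n ^ (t + 1) ≤ n ^ (t + 2) := by
    rcases n.eq_zero_or_pos with rfl | hn
    · simp
    · exact Nat.pow_le_pow_right hn (by omega)
  rw [recolorLength]
  calc (t + 2) * (2 * ∑ j ∈ Finset.range n, (2 * recolorLength t j + 2 * j + 1)
        + recolorLength t n)
      ≤ (t + 2) * (2 * (2 * D * ∑ j ∈ Finset.range n, j ^ (t + 1) + n ^ 2)
        + D * n ^ (t + 1)) := by
        gcongr
        exact h n
    _ = 4 * D * ((t + 1 + 1) * ∑ j ∈ Finset.range n, j ^ (t + 1)) + (t + 2) * 2 * n ^ 2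
        + (t + 2) * D * n ^ (t + 1) := by ring
    _ ≤ 4 * D * n ^ (t + 1 + 1) + (t + 2) * 2 * n ^ (t + 2)
        + (t + 2) * D * n ^ (t + 2) := by gcongr
    _ = _ := by ring

theorem recolorLength_le (t n : ℕ) : recolorLength t n ≤ 4 * 2 ^ t * n ^ (t + 1) := by
  have h₀ : ∀ n, recolorLength 0 n ≤ 1 * n ^ (0 + 1) := by simp [recolorLength]
  have h₁ : ∀ n, recolorLength 1 n ≤ 5 * n ^ (1 + 1) := fun n => by
    have := recolorLength_succ_le h₀ n
    norm_num at this ⊢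
    omega
  have h₂ : ∀ s n, recolorLength (s + 2) n ≤ (4 * 2 ^ (s + 2) - 2) * n ^ (s + 2 + 1) := by
    intro s
    induction s with
    | zero =>
      intro n
      have := recolorLength_succ_le h₁ n
      norm_num at this ⊢
      omega
    | succ s ih =>
      intro n
      have h := recolorLength_succ_le ih n
      obtain ⟨D, hD⟩ : ∃ D, 4 * 2 ^ (s + 2) = D + 2 := ⟨4 * 2 ^ (s + 2) - 2, by
        have := Nat.one_le_two_pow (n := s + 2)
        omega⟩
      have hD' : 4 * 2 ^ (s + 1 + 2) - 2 = 2 * D + 2 := by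
        have : 2 ^ (s + 1 + 2) = 2 * 2 ^ (s + 2) := by ring
        omega
      rw [hD, Nat.add_sub_cancel] at h
      rw [hD']
      refine Nat.le_of_mul_le_mul_left (h.trans ?_) (by omega : 0 < s + 2 + 2)
      rw [← mul_assoc]
      exact Nat.mul_le_mul_right _ (by nlinarith)
  match t with
  | 0 => exact (h₀ n).trans (Nat.mul_le_mul_right _ (by norm_num))
  | 1 => exact (h₁ n).trans (Nat.mul_le_mul_right _ (by norm_num))
  | s + 2 => exact (h₂ s n).trans (Nat.mul_le_mul_right _ (by omega))

theorem Degenerate.exists_injective {V : Type} [Fintype V] [DecidableEq V] {G : SimpleGraph V}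
    [DecidableRel G.Adj] {k : ℕ} (hG : Degenerate G k) :
    ∃ r : V → ℕ, r.Injective ∧ ∀ v, (outNbrs G r Finset.univ v).card ≤ k := by
  have key : ∀ A : Finset V, ∃ r : V → ℕ, Set.InjOn r A ∧
      ∀ v ∈ A, (outNbrs G r A v).card ≤ k := by
    intro A
    induction A using Finset.strongInduction with
    | H A ih =>
      rcases A.eq_empty_or_nonempty with rfl | hA
      · exact ⟨fun _ => 0, by simp, by simp⟩
      obtain ⟨v, hv, hdeg⟩ := hG A (by simpa using hA)
      rw [Finset.mem_coe] at hv
      obtain ⟨r, hr, hrk⟩ := ih _ (Finset.erase_ssubset hv)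
      refine ⟨fun u => if u = v then 0 else r u + 1, ?_, ?_⟩
      · intro x hx y hy hxy
        by_cases h₁ : x = v <;> by_cases h₂ : y = v <;> simp [h₁, h₂] at hxy ⊢
        exact hr (by simpa [h₁] using hx) (by simpa [h₂] using hy) hxy
      · intro u hu
        by_cases huv : u = v
        · subst huv
          refine le_trans ?_ hdeg
          rw [← Set.ncard_coe_finset]
          refine Set.ncard_le_ncard (fun w hw => ?_) (Set.toFinite _)
          have := mem_outNbrs.1 (Finset.mem_coe.1 hw)
          exact ⟨this.1, this.2.1⟩
        · refine le_trans (Finset.card_le_card fun w hw => ?_)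
            (hrk u (Finset.mem_erase.2 ⟨huv, hu⟩))
          obtain ⟨h₁, h₂, h₃⟩ := mem_outNbrs.1 hw
          by_cases hwv : w = v
          · simp [hwv] at h₃
          · simp only [huv, hwv, if_false] at h₃
            exact mem_outNbrs.2 ⟨Finset.mem_erase.2 ⟨hwv, h₁⟩, h₂, by omega⟩
  obtain ⟨r, hr, hrk⟩ := key Finset.univ
  exact ⟨r, by simpa [Set.injOn_univ] using hr, fun v => hrk v (Finset.mem_univ v)⟩

theorem isListColoring_univ_iff {V : Type} [Fintype V] {G : SimpleGraph V} {k : ℕ}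
    {f : V → Fin k} :
    IsListColoring G Finset.univ (fun _ => Finset.univ) f ↔ ProperColoring G k f := by
  simp [IsListColoring, ProperColoring]

theorem ReachIn.exists_recoloringSeq {V : Type} [Fintype V] {G : SimpleGraph V} {k m : ℕ}
    {f g : V → Fin k} (hf : ProperColoring G k f)
    (h : ReachIn (RecolorStep G Finset.univ fun _ => Finset.univ) m f g) :
    ∃ m' ≤ m, ∃ c : ℕ → V → Fin k, c 0 = f ∧ c m' = g ∧ RecoloringSeq G k m' c := by
  induction h with
  | refl m f =>
    exact ⟨0, Nat.zero_le m, fun _ => f, rfl, rfl, fun _ _ => hf, by simp⟩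
  | @tail m f g g' _ hs ih =>
    obtain ⟨m', hm', c, rfl, rfl, hc₁, hc₂⟩ := ih hf
    obtain ⟨-, hg', v, -, hv⟩ := hs
    by_cases hgg : c m' v = g' v
    · refine ⟨m', by omega, c, rfl, ?_, hc₁, hc₂⟩
      ext u
      by_cases hu : u = v
      · rw [hu, hgg]
      · rw [hv u hu]
    · refine ⟨m' + 1, by omega, fun i => if i ≤ m' then c i else g', by simp, by simp,
        fun i _ => ?_, fun i hi => ?_⟩
      · by_cases h : i ≤ m'
        · simpa [h] using hc₁ i h
        · simpa [h] using isListColoring_univ_iff.1 hg'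
      · by_cases h : i + 1 ≤ m'
        · simpa [h, (by omega : i ≤ m')] using hc₂ i h
        · obtain rfl : i = m' := by omega
          simp only [le_refl, if_true, h, if_false]
          exact ⟨v, hgg, fun u hu => by_contra fun huv => hu (hv u huv)⟩

/-- There is a constant `C` (independent of `k` and `n`) such that for all
`k, n ≥ 1` and every `k`-degenerate graph `G` on `n` vertices, the reconfiguration graph
`R_{k+2}(G)` is connected with diameter at most `C * 2^k * n^(k+1)`. -/
theorem statement5 :
    ∃ C : ℕ, ∀ (k n : ℕ), 1 ≤ k → 1 ≤ n →
      ∀ (V : Type) [Fintype V] [DecidableEq V] (G : SimpleGraph V),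
        Fintype.card V = n → Degenerate G k →
      ∀ α β : V → Fin (k + 2),
        ProperColoring G (k + 2) α → ProperColoring G (k + 2) β →
        ∃ m : ℕ, m ≤ C * 2 ^ k * n ^ (k + 1) ∧
          ∃ c : ℕ → V → Fin (k + 2), c 0 = α ∧ c m = β ∧ RecoloringSeq G (k + 2) m c := by
  classical
  refine ⟨4, fun k n _ _ V _ _ G hn hG α β hα hβ => ?_⟩
  obtain ⟨r, hr, hrk⟩ := hG.exists_injective
  have hreach := recolorBound_recolorLength (G := G) (κ := Fin (k + 2)) hr k Finset.univ
    (fun _ => Finset.univ) Finset.univ (by simp)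
    (fun v _ => ⟨subset_rfl, by simpa using hrk v⟩) α β
    (isListColoring_univ_iff.2 hα) (isListColoring_univ_iff.2 hβ) (by simp)
  obtain ⟨m, hm, c, hc⟩ := hreach.exists_recoloringSeq hα
  refine ⟨m, hm.trans ?_, c, hc⟩
  rw [Finset.card_univ, hn]
  exact recolorLength_le k n
end

section
/- Let d ≥ 1 be an integer and ε > 0, and let H be a finite simple graph with h ≥ 1 vertices whose maximum average degree is at most d − ε. Then H contains an independent set I such that every vertex of I has degree at most d − 1 in H and |I| ≥ ε·h / d². -/
/-- A set of vertices of degree less than `d` contains an independent subset of at least a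
`1 / d` proportion of its vertices. -/
theorem SimpleGraph.exists_isIndepSet_card_le_mul {V : Type*} [Fintype V] [DecidableEq V]
    (G : SimpleGraph V) [DecidableRel G.Adj] (d : ℕ) (S : Finset V)
    (hS : ∀ v ∈ S, G.degree v < d) :
    ∃ I ⊆ S, G.IsIndepSet (I : Set V) ∧ S.card ≤ d * I.card := by
  classical
  obtain ⟨I, hI, hmax⟩ := (S.powerset.filter fun I : Finset V => G.IsIndepSet (I : Set V)).exists_max_image
    Finset.card ⟨∅, by simp⟩
  simp only [Finset.mem_filter, Finset.mem_powerset] at hI hmax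
  refine ⟨I, hI.1, hI.2, ?_⟩
  have hcover : S ⊆ I.biUnion fun v => insert v (G.neighborFinset v) := by
    intro v hv
    by_contra hvI
    simp only [Finset.mem_biUnion, Finset.mem_insert, SimpleGraph.mem_neighborFinset, not_exists,
      not_and, not_or] at hvI
    have hnot : v ∉ I := fun h => (hvI v h).1 rfl
    have hle := hmax (insert v I) ⟨Finset.insert_subset hv hI.1, by
      rw [Finset.coe_insert, SimpleGraph.IsIndepSet, Set.pairwise_insert]
      exact ⟨hI.2, fun b hb _ => ⟨fun h => (hvI b hb).2 h.symm, (hvI b hb).2⟩⟩⟩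
    rw [Finset.card_insert_of_notMem hnot] at hle
    omega
  calc S.card ≤ _ := Finset.card_le_card hcover
    _ ≤ I.card * d := Finset.card_biUnion_le_card_mul _ _ _ fun v hv =>
        (Finset.card_insert_le _ _).trans (hS v (hI.1 hv))
    _ = d * I.card := mul_comm _ _

/-- If the degree sum is at most `(d - ε) * |V|`, then at least `ε * |V| / d` vertices have degree
less than `d`. -/
theorem SimpleGraph.mul_card_le_mul_card_degree_lt {V : Type*} [Fintype V]
    (G : SimpleGraph V) [DecidableRel G.Adj] (d : ℕ) (ε : ℝ)
    (h : 2 * (G.edgeFinset.card : ℝ) ≤ (d - ε) * Fintype.card V) :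
    ε * Fintype.card V ≤ d * (Finset.univ.filter fun v => G.degree v < d).card := by
  have hsum : ∑ v, (G.degree v : ℝ) = 2 * G.edgeFinset.card :=
    mod_cast G.sum_degrees_eq_twice_card_edges
  have hbound : ∑ v, ((d : ℝ) - G.degree v) ≤ ∑ v, if G.degree v < d then (d : ℝ) else 0 := by
    refine Finset.sum_le_sum fun v _ => ?_
    split_ifs with hv
    · simp
    · simpa using hv
  rw [Finset.sum_sub_distrib, hsum, ← Finset.sum_filter] at hbound
  simp only [Finset.sum_const, nsmul_eq_mul, Finset.card_univ] at hbound
  linarith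

/-- Let `d ≥ 1` be an integer, `ε > 0`, and let `H` be a finite simple graph
with `h ≥ 1` vertices and maximum average degree at most `d − ε`. Then `H` contains an
independent set `I` whose vertices all have degree at most `d − 1` in `H` and with
`|I| ≥ ε·h/d²`. -/
theorem statement6 (d : ℕ) (hd : 1 ≤ d) (ε : ℝ) (hε : 0 < ε)
    (V : Type) [Fintype V] [DecidableEq V] (H : SimpleGraph V)
    (hcard : 1 ≤ Fintype.card V)
    (hmad : ∀ K : H.Subgraph, K.verts.Nonempty →
      2 * (K.edgeSet.ncard : ℝ) ≤ ((d : ℝ) - ε) * K.verts.ncard) :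
    ∃ I : Set V,
      (∀ u ∈ I, ∀ v ∈ I, ¬ H.Adj u v) ∧
      (∀ v ∈ I, {u : V | H.Adj v u}.ncard ≤ d - 1) ∧
      ε * (Fintype.card V : ℝ) / (d : ℝ) ^ 2 ≤ (I.ncard : ℝ) := by
  classical
  have : Nonempty V := Fintype.card_pos_iff.mp hcard
  have hedges : 2 * (H.edgeFinset.card : ℝ) ≤ (d - ε) * Fintype.card V := by
    simpa [← SimpleGraph.coe_edgeFinset, Set.ncard_coe_finset, Set.ncard_univ]
      using hmad ⊤ (by simp)
  obtain ⟨I, hIS, hind, hle⟩ := H.exists_isIndepSet_card_le_mul d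
    (Finset.univ.filter fun v => H.degree v < d) (by simp)
  refine ⟨I, fun u hu v hv h => hind hu hv h.ne h, fun v hv => ?_, ?_⟩
  · have hdeg : H.degree v < d := (Finset.mem_filter.mp (hIS hv)).2
    have hcard_eq : {u : V | H.Adj v u}.ncard = H.degree v := by
      rw [← SimpleGraph.card_neighborFinset_eq_degree, ← Set.ncard_coe_finset]
      congr 1
      ext u
      simp
    omega
  · have hd0 : (0 : ℝ) < d := mod_cast hd
    rw [Set.ncard_coe_finset, div_le_iff₀ (by positivity)]
    calc ε * Fintype.card V ≤ d * (Finset.univ.filter fun v => H.degree v < d).card :=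
          H.mul_card_le_mul_card_degree_lt d ε hedges
      _ ≤ d * (d * I.card) := by gcongr; exact mod_cast hle
      _ = I.card * (d : ℝ) ^ 2 := by ring
end

section
/- Let d ≥ 1 be an integer and ε > 0. There is a constant C (depending only on d and ε) such that every finite simple graph G with n ≥ 2 vertices and maximum average degree at most d − ε has degree depth (d − 1, t) for some integer t ≤ C · log n; that is, there is a partition {I_1, …, I_t} of V(G) with t ≤ C · log n such that I_1 is a (d−1)-independent set of G and, for i ∈ {2, …, t}, I_i is a (d−1)-independent set of G ∖ (I_1 ∪ ⋯ ∪ I_{i−1}). -/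
open Finset

open Classical in
/-- The degree sum of an induced subgraph is at most twice its number of edges. -/
theorem sum_card_adj_le_two_mul_ncard_edgeSet {V : Type*} [Fintype V] (G : SimpleGraph V)
    (A : Finset V) :
    ∑ v ∈ A, #{u ∈ A | G.Adj v u} ≤ 2 * ((⊤ : G.Subgraph).induce (A : Set V)).edgeSet.ncard := by
  set H := (⊤ : G.Subgraph).induce (A : Set V) with hH
  have h := H.spanningCoe.sum_degrees_eq_twice_card_edges
  have hE : #H.spanningCoe.edgeFinset = H.edgeSet.ncard := by
    rw [← SimpleGraph.Subgraph.edgeSet_spanningCoe, ← SimpleGraph.coe_edgeFinset,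
      Set.ncard_coe_finset]
  rw [← hE, ← h]
  refine (Finset.sum_le_sum fun v hv => ?_).trans
    (Finset.sum_le_sum_of_subset (subset_univ A))
  rw [← SimpleGraph.card_neighborFinset_eq_degree]
  refine card_le_card fun u hu => ?_
  simp only [mem_filter] at hu
  simp [hH, hv, hu]

open Classical in
/-- A set of vertices whose degrees within a set `A` are less than `d` contains an independent set
comprising at least a `1 / d` fraction of it. -/
theorem exists_independent_subset_card_le_mul {V : Type*} (G : SimpleGraph V) (d : ℕ)
    (A L : Finset V) (hLA : L ⊆ A) (hdeg : ∀ v ∈ L, #{u ∈ A | G.Adj v u} < d) :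
    ∃ I ⊆ L, (∀ u ∈ I, ∀ v ∈ I, ¬ G.Adj u v) ∧ #L ≤ d * #I := by
  obtain ⟨I, hI, hmax⟩ := exists_max_image
    {I ∈ L.powerset | ∀ u ∈ I, ∀ v ∈ I, ¬ G.Adj u v} card ⟨∅, by simp⟩
  simp only [mem_filter, mem_powerset] at hI hmax
  refine ⟨I, hI.1, hI.2, ?_⟩
  have hcov : L ⊆ I.biUnion fun v => insert v {u ∈ A | G.Adj v u} := by
    intro w hw
    by_contra hcon
    simp only [mem_biUnion, mem_insert, mem_filter, not_exists, not_and, not_or] at hcon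
    have hwI : w ∉ I := fun h => (hcon w h).1 rfl
    have hnadj : ∀ v ∈ I, ¬ G.Adj v w := fun v hv => (hcon v hv).2 (hLA hw)
    have hle := hmax (insert w I) ⟨insert_subset hw hI.1, by
      intro u hu v hv
      rcases mem_insert.1 hu with rfl | huI <;> rcases mem_insert.1 hv with rfl | hvI
      · exact G.irrefl
      · exact fun h => hnadj v hvI h.symm
      · exact hnadj u huI
      · exact hI.2 u huI v hvI⟩
    rw [card_insert_of_notMem hwI] at hle
    omega
  calc #L ≤ _ := card_le_card hcov
    _ ≤ #I * d := card_biUnion_le_card_mul _ _ _ fun v hv =>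
        (card_insert_le _ _).trans (hdeg v (hI.1 hv))
    _ = d * #I := mul_comm _ _

open Classical in
/-- If the average degree on `A` is at most `d - ε`, then `A` contains an independent set of
vertices of degree less than `d` comprising at least an `ε / d ^ 2` fraction of `A`. -/
theorem exists_independent_subset_of_sum_card_adj_le {V : Type*} (G : SimpleGraph V) (d : ℕ)
    (hd : 1 ≤ d) (ε : ℝ) (A : Finset V)
    (hA : ((∑ v ∈ A, #{u ∈ A | G.Adj v u} : ℕ) : ℝ) ≤ (d - ε) * #A) :
    ∃ I ⊆ A, (∀ u ∈ I, ∀ v ∈ I, ¬ G.Adj u v) ∧ (∀ v ∈ I, #{u ∈ A | G.Adj v u} < d) ∧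
      ε / d ^ 2 * #A ≤ #I := by
  set L : Finset V := {v ∈ A | #{u ∈ A | G.Adj v u} < d} with hL
  obtain ⟨I, hIL, hind, hcard⟩ := exists_independent_subset_card_le_mul G d A L
    (filter_subset _ _) fun v hv => (mem_filter.1 hv).2
  refine ⟨I, hIL.trans (filter_subset _ _), hind, fun v hv => (mem_filter.1 (hIL hv)).2, ?_⟩
  have hhigh : #(A \ L) * d ≤ ∑ v ∈ A, #{u ∈ A | G.Adj v u} := by
    refine le_trans ?_ (sum_le_sum_of_subset (sdiff_subset : A \ L ⊆ A))
    rw [← smul_eq_mul]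
    refine card_nsmul_le_sum _ _ _ fun v hv => ?_
    simp only [hL, mem_sdiff, mem_filter, not_and, not_lt] at hv
    exact hv.2 hv.1
  have hsplit : #(A \ L) + #L = #A := card_sdiff_add_card_eq_card (filter_subset _ _)
  have hhigh' : (#(A \ L) : ℝ) * d ≤ (d - ε) * #A := le_trans (by exact_mod_cast hhigh) hA
  have hsplit' : (#(A \ L) : ℝ) + #L = #A := by exact_mod_cast hsplit
  have hcard' : (#L : ℝ) ≤ d * #I := by exact_mod_cast hcard
  have hd' : (0 : ℝ) < d := by exact_mod_cast hd
  rw [div_mul_eq_mul_div, div_le_iff₀ (by positivity)]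
  nlinarith [mul_le_mul_of_nonneg_left hcard' hd'.le]

open Classical in
/-- Repeatedly removing an independent set of vertices of degree at most `s` comprising a `c`
fraction of the remaining vertices exhausts fewer than `exp (c * k)` vertices in `k` rounds; `f v`
is the round in which `v` is removed. -/
theorem exists_removal_time {V : Type*} (G : SimpleGraph V) (s : ℕ) (c : ℝ)
    (hstep : ∀ A : Finset V, ∃ I ⊆ A, (∀ u ∈ I, ∀ v ∈ I, ¬ G.Adj u v) ∧
      (∀ v ∈ I, #{u ∈ A | G.Adj v u} ≤ s) ∧ c * #A ≤ #I)
    (k : ℕ) (A : Finset V) (hA : (#A : ℝ) < Real.exp (c * k)) :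
    ∃ f : V → ℕ, (∀ v ∈ A, f v < k) ∧ (∀ u ∈ A, ∀ v ∈ A, f u = f v → ¬ G.Adj u v) ∧
      ∀ v ∈ A, #{u ∈ A | G.Adj v u ∧ f v ≤ f u} ≤ s := by
  induction k generalizing A with
  | zero =>
    have : A = ∅ := by simpa using hA
    subst this
    exact ⟨fun _ => 0, by simp⟩
  | succ k ih =>
    obtain ⟨I, hIA, hind, hdeg, hcard⟩ := hstep A
    have hlt : (#(A \ I) : ℝ) < Real.exp (c * k) := by
      have hsplit : (#(A \ I) : ℝ) + #I = #A := by
        exact_mod_cast card_sdiff_add_card_eq_card hIA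
      calc (#(A \ I) : ℝ) ≤ (-c + 1) * #A := by linarith
        _ ≤ Real.exp (-c) * #A := by gcongr; exact Real.add_one_le_exp _
        _ < Real.exp (-c) * Real.exp (c * (k + 1 : ℕ)) := by gcongr
        _ = Real.exp (c * k) := by rw [← Real.exp_add]; push_cast; ring_nf
    obtain ⟨f, hlt, hf, hfdeg⟩ := ih (A \ I) hlt
    refine ⟨fun v => if v ∈ I then 0 else f v + 1, fun v hv => ?_, fun u hu v hv => ?_,
      fun v hv => ?_⟩
    · by_cases h : v ∈ I
      · simp [h]
      · simpa [h] using hlt v (mem_sdiff.2 ⟨hv, h⟩)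
    · by_cases h : u ∈ I <;> by_cases h' : v ∈ I
      · exact fun _ => hind u h v h'
      · simp [h, h']
      · simp [h, h']
      · simpa [h, h'] using hf u (mem_sdiff.2 ⟨hu, h⟩) v (mem_sdiff.2 ⟨hv, h'⟩)
    · by_cases h : v ∈ I
      · simpa [h] using hdeg v h
      · refine (card_le_card fun u hu => ?_).trans (hfdeg v (mem_sdiff.2 ⟨hv, h⟩))
        by_cases h' : u ∈ I
        · simp [h, h'] at hu
        · simpa [h, h'] using hu

/-- For every integer `d ≥ 1` and real `ε > 0` there is a constant `C`
such that every finite simple graph `G` with `n ≥ 2` vertices and maximum average degree at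
most `d − ε` has degree depth `(d − 1, t)` for some `t ≤ C · log n`. -/
theorem statement7 (d : ℕ) (hd : 1 ≤ d) (ε : ℝ) (hε : 0 < ε) :
    ∃ C : ℝ, ∀ (V : Type) [Fintype V] [DecidableEq V] (G : SimpleGraph V),
      2 ≤ Fintype.card V →
      (∀ H : G.Subgraph, H.verts.Nonempty →
        2 * (H.edgeSet.ncard : ℝ) ≤ ((d : ℝ) - ε) * H.verts.ncard) →
      ∃ t : ℕ, 1 ≤ t ∧ (t : ℝ) ≤ C * Real.log (Fintype.card V) ∧
        ∃ P : Fin t → Set V, IsDegreePartition G (d - 1) t P := by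
  classical
  set c : ℝ := ε / d ^ 2 with hc_def
  have hd' : (0 : ℝ) < d := by exact_mod_cast hd
  have hc : 0 < c := by positivity
  refine ⟨1 / c + 1 / Real.log 2, fun V _ _ G hn hmad => ?_⟩
  have hlog2 : 0 < Real.log 2 := Real.log_pos one_lt_two
  have hn' : (2 : ℝ) ≤ Fintype.card V := by exact_mod_cast hn
  have hlog : Real.log 2 ≤ Real.log (Fintype.card V) := Real.log_le_log two_pos hn'
  have hstep : ∀ A : Finset V, ∃ I ⊆ A, (∀ u ∈ I, ∀ v ∈ I, ¬ G.Adj u v) ∧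
      (∀ v ∈ I, #{u ∈ A | G.Adj v u} ≤ d - 1) ∧ c * #A ≤ #I := by
    intro A
    rcases A.eq_empty_or_nonempty with rfl | hA
    · exact ⟨∅, by simp⟩
    have hsum : ((∑ v ∈ A, #{u ∈ A | G.Adj v u} : ℕ) : ℝ) ≤ (d - ε) * #A := by
      have h := hmad ((⊤ : G.Subgraph).induce (A : Set V)) (by simpa using hA)
      rw [SimpleGraph.Subgraph.induce_verts, Set.ncard_coe_finset] at h
      exact le_trans (by exact_mod_cast sum_card_adj_le_two_mul_ncard_edgeSet G A) h
    obtain ⟨I, hIA, hind, hdeg, hcard⟩ :=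
      exists_independent_subset_of_sum_card_adj_le G d hd ε A hsum
    exact ⟨I, hIA, hind, fun v hv => Nat.le_sub_one_of_lt (hdeg v hv), hcard⟩
  set q : ℝ := Real.log (Fintype.card V) / c with hq
  have hq0 : 0 ≤ q := div_nonneg (hlog2.le.trans hlog) hc.le
  have hexp : (#(univ : Finset V) : ℝ) < Real.exp (c * (⌊q⌋₊ + 1 : ℕ)) := by
    rw [card_univ, ← Real.log_lt_iff_lt_exp (by linarith), mul_comm, ← div_lt_iff₀ hc]
    exact_mod_cast Nat.lt_floor_add_one q
  obtain ⟨f, hlt, hind, hdeg⟩ := exists_removal_time G (d - 1) c hstep _ univ hexp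
  simp only [mem_univ, forall_const] at hlt hind hdeg
  refine ⟨⌊q⌋₊ + 1, by omega, ?_, fun i => {v | f v = i},
    fun v => ⟨⟨f v, hlt v⟩, rfl, fun i hi => Fin.ext hi.symm⟩,
    fun i u hu v hv => hind u v (hu.trans hv.symm), fun i v hv => ?_⟩
  · have h1 : 1 ≤ 1 / Real.log 2 * Real.log (Fintype.card V) := by
      rw [one_div_mul_eq_div, one_le_div hlog2]
      exact hlog
    have h2 : 1 / c * Real.log (Fintype.card V) = q := one_div_mul_eq_div _ _
    push_cast
    linarith [Nat.floor_le hq0]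
  · refine le_trans ?_ (hdeg v)
    rw [← Set.ncard_coe_finset]
    refine Set.ncard_le_ncard ?_ (Set.toFinite _)
    rintro u ⟨hadj, j, hij, hu⟩
    have hv : f v = i := hv
    have hu : f u = j := hu
    simpa [hadj, hv, hu] using hij
end
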